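/- There exist absolute constants C > 0 and N_0 such that the following holds for all n ≥ N_0. Let (d_1,…,d_n) be positive integers with even sum whose average d = (1/n)Σ_j d_j equals 2 + 2x/n for some real x with (1/2)·d_max^4 ≤ x ≤ n^{1/2}, where d_max = max_j d_j. Then the expected number E τ_d of spanning trees of a uniformly random graph with degree sequence (d_1,…,d_n) satisfies E τ_d = (1/n)·(e/2)^x · (n/(2x))^{3/2 + x} · (d̂/2)^n · exp( (6+R)(2+R)/16 + 3x²/(2n) + E ), where |E| ≤ C·( d_max^4/x + x³/n² ). -/

import Mathlib

attribute [local instance] Classical.propDecidable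

/-- The number of spanning trees of a simple graph on `Fin n`. -/
noncomputable def spanningTreeCount {n : ℕ} (G : SimpleGraph (Fin n)) : ℕ :=
  (Finset.univ.filter (fun T : SimpleGraph (Fin n) => T ≤ G ∧ T.IsTree)).card

section DegreeBasics

open Finset

variable {V : Type}

lemma adj_symmDiff {G H : SimpleGraph V} {a b : V} :
    (symmDiff G H).Adj a b ↔ ((G.Adj a b ∧ ¬ H.Adj a b) ∨ (H.Adj a b ∧ ¬ G.Adj a b)) := by
  simp [symmDiff]

variable [Fintype V]

/-- The simple graphs on `V` with prescribed degrees. -/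
noncomputable def graphsWithDegrees (d : V → ℕ) : Finset (SimpleGraph V) :=
  univ.filter fun G => ∀ v, G.degree v = d v

lemma mem_graphsWithDegrees {d : V → ℕ} {G : SimpleGraph V} :
    G ∈ graphsWithDegrees d ↔ ∀ v, G.degree v = d v := by
  simp [graphsWithDegrees]

lemma degree_eq_card_filter (G : SimpleGraph V) (v : V) :
    G.degree v = #{w | G.Adj v w} := by
  rw [← SimpleGraph.card_neighborFinset_eq_degree]
  congr 1
  ext w
  simp

lemma degree_symmDiff_edge {G : SimpleGraph V} {a b : V} (hab : a ≠ b) (h : ¬ G.Adj a b) (v : V) :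
    (symmDiff G (SimpleGraph.edge a b)).degree v
      = G.degree v + (if v = a then 1 else 0) + (if v = b then 1 else 0) := by
  have key : ∀ v c : V, ¬ G.Adj v c →
      (∀ w, (symmDiff G (SimpleGraph.edge a b)).Adj v w ↔ (w = c ∨ G.Adj v w)) →
      (symmDiff G (SimpleGraph.edge a b)).degree v = G.degree v + 1 := by
    intro v c hc hw
    rw [degree_eq_card_filter, degree_eq_card_filter, ← card_insert_of_notMem (a := c)]
    · congr 1
      ext w
      simp [hw]
    · simpa using hc
  have h' : ¬ G.Adj b a := fun hh => h hh.symm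
  by_cases hva : v = a
  · subst hva
    rw [key v b h (by intro w; rw [adj_symmDiff, SimpleGraph.edge_adj]; grind)]
    simp [hab]
  by_cases hvb : v = b
  · subst hvb
    rw [key v a h' (by intro w; rw [adj_symmDiff, SimpleGraph.edge_adj]; grind)]
    simp [hva]
  · simp only [hva, hvb, if_false, add_zero]
    rw [degree_eq_card_filter, degree_eq_card_filter]
    congr 1
    ext w
    simp only [mem_filter, mem_univ, true_and, adj_symmDiff, SimpleGraph.edge_adj]
    grind

/-- Deleting the edge `ab` is a bijection onto the graphs with reduced degrees avoiding `ab`. -/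
lemma card_filter_adj_eq {d d' : V → ℕ} {a b : V} (hab : a ≠ b)
    (hd : ∀ v, d v = d' v + (if v = a then 1 else 0) + (if v = b then 1 else 0)) :
    #{G ∈ graphsWithDegrees d | G.Adj a b} = #{G ∈ graphsWithDegrees d' | ¬ G.Adj a b} := by
  refine card_nbij' (fun G => symmDiff G (SimpleGraph.edge a b))
    (fun G => symmDiff G (SimpleGraph.edge a b)) ?_ ?_ ?_ ?_
  · intro G hG
    simp only [coe_filter, Set.mem_ofPred_eq, mem_graphsWithDegrees] at hG ⊢
    have hn : ¬ (symmDiff G (SimpleGraph.edge a b)).Adj a b := by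
      rw [adj_symmDiff, SimpleGraph.edge_adj]; grind
    refine ⟨fun v => ?_, hn⟩
    have := degree_symmDiff_edge hab hn v
    rw [symmDiff_symmDiff_cancel_right, hG.1 v, hd v] at this
    omega
  · intro G hG
    simp only [coe_filter, Set.mem_ofPred_eq, mem_graphsWithDegrees] at hG ⊢
    refine ⟨fun v => ?_, ?_⟩
    · rw [degree_symmDiff_edge hab hG.2, hG.1, hd]
    · rw [adj_symmDiff, SimpleGraph.edge_adj]; grind
  · intro G _; simp
  · intro G _; simp

lemma sum_indicator_adj (G : SimpleGraph V) (v : V) :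
    ∑ w, (if G.Adj v w then 1 else 0) = G.degree v := by
  rw [degree_eq_card_filter, card_filter]

lemma exists_unique_adj_of_degree_one {G : SimpleGraph V} {v : V} (h : G.degree v = 1) :
    ∃ c, ∀ w, G.Adj v w ↔ w = c := by
  rw [degree_eq_card_filter, card_eq_one] at h
  obtain ⟨c, hc⟩ := h
  refine ⟨c, fun w => ?_⟩
  have := congrArg (fun s => w ∈ s) hc
  simpa using this

end DegreeBasics

section Splitting

open Finset

variable {V : Type}

/-- Detach the edge `ac` of `H` from `a`, and attach it to the new vertex `none`. -/
def splitGraph (H : SimpleGraph V) (a c : V) : SimpleGraph (Option V) where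
  Adj
    | none, none => False
    | none, some v => v = c
    | some v, none => v = c
    | some u, some v => H.Adj u v ∧ ¬ (u = a ∧ v = c) ∧ ¬ (u = c ∧ v = a)
  symm := ⟨by
    rintro (_ | u) (_ | v) h
    · exact h
    · exact h
    · exact h
    · exact ⟨h.1.symm, by tauto, by tauto⟩⟩
  loopless := ⟨by
    rintro (_ | u) h
    · exact h
    · exact H.loopless.irrefl u h.1⟩

@[simp] lemma splitGraph_none_some {H : SimpleGraph V} {a c v : V} :
    (splitGraph H a c).Adj none (some v) ↔ v = c := Iff.rfl

@[simp] lemma splitGraph_some_none {H : SimpleGraph V} {a c v : V} :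
    (splitGraph H a c).Adj (some v) none ↔ v = c := Iff.rfl

@[simp] lemma splitGraph_some_some {H : SimpleGraph V} {a c u v : V} :
    (splitGraph H a c).Adj (some u) (some v) ↔
      H.Adj u v ∧ ¬ (u = a ∧ v = c) ∧ ¬ (u = c ∧ v = a) := Iff.rfl

variable [Fintype V]

/-- Degrees after detaching one edge from `a` and attaching it to a new vertex `none`. -/
noncomputable def splitDegrees (d : V → ℕ) (a : V) : Option V → ℕ
  | none => 1
  | some v => if v = a then d v - 1 else d v

lemma degree_option (G : SimpleGraph (Option V)) (o : Option V) :
    G.degree o = (if G.Adj o none then 1 else 0) + #{w : V | G.Adj o (some w)} := by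
  rw [← sum_indicator_adj, Fintype.sum_option, card_filter]

lemma degree_splitGraph {H : SimpleGraph V} {a c : V} (h : H.Adj a c) (v : V) :
    (splitGraph H a c).degree (some v) + (if v = a then 1 else 0) = H.degree v := by
  have hac : a ≠ c := h.ne
  rw [degree_option, degree_eq_card_filter]
  simp only [splitGraph_some_none, splitGraph_some_some]
  by_cases hva : v = a
  · subst hva
    simp only [hac, if_false, zero_add, if_true]
    have : ({w | H.Adj v w ∧ ¬ (v = v ∧ w = c) ∧ ¬ (v = c ∧ w = v)} : Finset V)
        = ({w | H.Adj v w} : Finset V).erase c := by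
      ext w; simp; grind
    simp only [false_and, not_false_eq_true, and_true, true_and, hac] at this ⊢
    rw [this, card_erase_add_one]
    simpa using h
  by_cases hvc : v = c
  · subst hvc
    have : ({w | H.Adj v w ∧ ¬ (v = a ∧ w = v) ∧ ¬ (v = v ∧ w = a)} : Finset V)
        = ({w | H.Adj v w} : Finset V).erase a := by
      ext w; simp; grind
    simp only [hva, if_false, if_true, add_zero]
    simp only [hva] at this
    rw [this, add_comm, card_erase_add_one]
    simpa using h.symm
  · simp [hva, hvc]

/-- The graphs in which merging the leaf `ℓ` into `a` creates a loop or a multiple edge. -/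
noncomputable def mergeObstructed {W : Type} [Fintype W] (d : W → ℕ) (ℓ a : W) :
    Finset (SimpleGraph W) :=
  {G ∈ graphsWithDegrees d | ∃ c, G.Adj ℓ c ∧ (c = a ∨ G.Adj a c)}

lemma mergeObstructed_subset {W : Type} [Fintype W] (d : W → ℕ) (ℓ a : W) :
    mergeObstructed d ℓ a ⊆ graphsWithDegrees d := filter_subset _ _

lemma mul_card_graphsWithDegrees {d : V → ℕ} {a : V} (ha : 1 ≤ d a) :
    d a * #(graphsWithDegrees d) =
      #(graphsWithDegrees (splitDegrees d a) \ mergeObstructed (splitDegrees d a) none (some a)) := by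
  have h1 : d a * #(graphsWithDegrees d)
      = #((graphsWithDegrees d).sigma fun H => ({c | H.Adj a c} : Finset V)) := by
    rw [card_sigma, mul_comm, ← smul_eq_mul, ← sum_const]
    refine sum_congr rfl fun H hH => ?_
    rw [← degree_eq_card_filter, mem_graphsWithDegrees.1 hH]
  rw [h1]
  refine card_bij (fun p _ => splitGraph p.1 a p.2) ?_ ?_ ?_
  · rintro ⟨H, c⟩ hp
    simp only [mem_sigma, mem_filter, mem_univ, true_and, mem_graphsWithDegrees] at hp
    obtain ⟨hH, hac⟩ := hp
    simp only [mem_sdiff, mergeObstructed, mem_filter, mem_graphsWithDegrees, not_and]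
    refine ⟨?_, fun _ => ?_⟩
    · rintro (_ | v)
      · rw [degree_option]
        simp only [SimpleGraph.irrefl, if_false, zero_add, splitGraph_none_some, splitDegrees]
        exact card_eq_one.2 ⟨c, by ext; simp⟩
      · have := degree_splitGraph hac v
        simp only [splitDegrees]
        rw [hH] at this
        split_ifs at this ⊢ <;> omega
    · rintro ⟨_ | v, h, h'⟩
      · exact (splitGraph H a c).loopless.irrefl _ h
      · rw [splitGraph_none_some] at h
        subst h
        rcases h' with h' | h'
        · exact hac.ne (Option.some.inj h').symm
        · rw [splitGraph_some_some] at h'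
          exact h'.2.1 ⟨rfl, rfl⟩
  · rintro ⟨H, c⟩ hp ⟨H', c'⟩ hp' heq
    simp only [mem_sigma, mem_filter, mem_univ, true_and, mem_graphsWithDegrees] at hp hp' heq
    have hc : c = c' := by
      have : (splitGraph H' a c').Adj none (some c) := by rw [← heq]; simp
      simpa using this
    subst hc
    have : H = H' := by
      ext u v
      have h2 : (splitGraph H a c).Adj (some u) (some v) ↔
          (splitGraph H' a c).Adj (some u) (some v) := by rw [heq]
      simp only [splitGraph_some_some] at h2
      have := hp.2; have := hp'.2; have := hp.2.symm; have := hp'.2.symm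
      grind
    subst this
    rfl
  · intro G hG
    simp only [mem_sdiff, mergeObstructed, mem_filter, mem_graphsWithDegrees, not_and] at hG
    obtain ⟨hd, hno⟩ := hG
    have hno := hno hd
    obtain ⟨c₀, hc₀⟩ := exists_unique_adj_of_degree_one (hd none)
    obtain _ | c := c₀
    · exact absurd ((hc₀ none).2 rfl) (G.loopless.irrefl _)
    have hca : c ≠ a := by
      rintro rfl; exact hno ⟨some c, (hc₀ _).2 rfl, Or.inl rfl⟩
    have hnac : ¬ G.Adj (some a) (some c) := fun h => hno ⟨some c, (hc₀ _).2 rfl, Or.inr h⟩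
    have hnca : ¬ G.Adj (some c) (some a) := fun h => hnac h.symm
    let H : SimpleGraph V :=
      { Adj := fun u v => G.Adj (some u) (some v) ∨ (u = a ∧ v = c) ∨ (u = c ∧ v = a)
        symm := ⟨fun u v h => by
          rcases h with h | h | h
          · exact Or.inl h.symm
          · exact Or.inr (Or.inr ⟨h.2, h.1⟩)
          · exact Or.inr (Or.inl ⟨h.2, h.1⟩)⟩
        loopless := ⟨fun u h => by
          rcases h with h | h | h
          · exact G.loopless.irrefl _ h
          · exact hca (h.2.symm.trans h.1)
          · exact hca (h.1.symm.trans h.2)⟩ }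
    have hHac : H.Adj a c := Or.inr (Or.inl ⟨rfl, rfl⟩)
    have hsplit : splitGraph H a c = G := by
      ext o o'
      rcases o with _ | u <;> rcases o' with _ | v
      · exact iff_of_false (SimpleGraph.loopless _ |>.irrefl _) (G.loopless.irrefl _)
      · rw [splitGraph_none_some, hc₀, Option.some_inj]
      · rw [splitGraph_some_none, G.adj_comm, hc₀, Option.some_inj]
      · rw [splitGraph_some_some]
        change (G.Adj (some u) (some v) ∨ _) ∧ _ ↔ _
        grind
    refine ⟨⟨H, c⟩, ?_, hsplit⟩
    simp only [mem_sigma, mem_filter, mem_univ, true_and, mem_graphsWithDegrees]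
    refine ⟨fun v => ?_, hHac⟩
    have h3 := degree_splitGraph hHac v
    rw [hsplit, hd] at h3
    simp only [splitDegrees] at h3
    rw [← h3]
    split_ifs with h
    · subst h; omega
    · omega

end Splitting

section CrudeBounds

open Finset

/-- The product `1 * 3 * ⋯ * (2 * m - 1)`. -/
def oddFactorial (m : ℕ) : ℕ := ∏ i ∈ range m, (2 * i + 1)

lemma oddFactorial_succ (m : ℕ) : oddFactorial (m + 1) = (2 * m + 1) * oddFactorial m := by
  rw [oddFactorial, prod_range_succ, mul_comm, oddFactorial]

lemma oddFactorial_pos (m : ℕ) : 0 < oddFactorial m := prod_pos fun _ _ => by omega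

lemma two_mul_factorial (m : ℕ) :
    (2 * m).factorial = 2 ^ m * m.factorial * oddFactorial m := by
  induction m with
  | zero => simp [oddFactorial]
  | succ m ih =>
    rw [oddFactorial_succ, Nat.mul_succ, Nat.factorial_succ, Nat.factorial_succ, ih,
      Nat.factorial_succ m]
    ring

variable {V : Type} [Fintype V]

lemma sum_card_filter_adj (d : V → ℕ) (v : V) :
    ∑ b, #{G ∈ graphsWithDegrees d | G.Adj v b} = d v * #(graphsWithDegrees d) := by
  simp_rw [card_filter]
  rw [sum_comm]
  rw [mul_comm, ← smul_eq_mul, ← sum_const]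
  refine sum_congr rfl fun G hG => ?_
  rw [sum_indicator_adj, mem_graphsWithDegrees.1 hG]

lemma pos_of_adj {d : V → ℕ} {G : SimpleGraph V} (hG : G ∈ graphsWithDegrees d) {v w : V}
    (h : G.Adj v w) : 1 ≤ d v := by
  rw [← mem_graphsWithDegrees.1 hG v, degree_eq_card_filter, Nat.one_le_iff_ne_zero, card_ne_zero]
  exact ⟨w, by simpa using h⟩

/-- Reduce the degrees of `a` and `b` by one. -/
noncomputable def reduceDegrees {V : Type} (d : V → ℕ) (a b : V) : V → ℕ := fun v =>
  d v - (if v = a then 1 else 0) - (if v = b then 1 else 0)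

lemma eq_reduceDegrees_add {V : Type} {d : V → ℕ} {a b : V} (hab : a ≠ b) (ha : 1 ≤ d a) (hb : 1 ≤ d b)
    (v : V) : d v =
      reduceDegrees d a b v + (if v = a then 1 else 0) + (if v = b then 1 else 0) := by
  unfold reduceDegrees
  by_cases h1 : v = a
  · subst h1
    simp only [if_true, hab, if_false]
    omega
  · by_cases h2 : v = b
    · subst h2
      simp only [h1, if_true, if_false]
      omega
    · simp [h1, h2]

lemma sum_reduceDegrees {d : V → ℕ} {a b : V} (hab : a ≠ b) (ha : 1 ≤ d a) (hb : 1 ≤ d b) :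
    ∑ v, d v = ∑ v, reduceDegrees d a b v + 2 := by
  rw [sum_congr rfl fun v _ => eq_reduceDegrees_add hab ha hb v]
  simp [sum_add_distrib]

lemma prod_factorial_reduceDegrees {d : V → ℕ} {a b : V} (hab : a ≠ b) (ha : 1 ≤ d a)
    (hb : 1 ≤ d b) :
    ∏ v, (d v).factorial = d a * d b * ∏ v, (reduceDegrees d a b v).factorial := by
  have h : ∀ v, (d v).factorial = (if v = a then d a else 1) * (if v = b then d b else 1) *
      (reduceDegrees d a b v).factorial := by
    intro v
    unfold reduceDegrees
    by_cases h1 : v = a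
    · subst h1
      simp only [if_true, hab, if_false, mul_one, Nat.sub_zero]
      exact (Nat.mul_factorial_pred (by omega)).symm
    · by_cases h2 : v = b
      · subst h2
        simp only [if_true, h1, if_false, one_mul, Nat.sub_zero]
        exact (Nat.mul_factorial_pred (by omega)).symm
      · simp [h1, h2]
  rw [prod_congr rfl fun v _ => h v, prod_mul_distrib, prod_mul_distrib, prod_ite_eq',
    prod_ite_eq']
  simp only [mem_univ, if_true]

lemma card_filter_adj_le {d : V → ℕ} {a b : V} (hab : a ≠ b) (ha : 1 ≤ d a) (hb : 1 ≤ d b) :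
    #{G ∈ graphsWithDegrees d | G.Adj a b} ≤ #(graphsWithDegrees (reduceDegrees d a b)) := by
  rw [card_filter_adj_eq hab (eq_reduceDegrees_add hab ha hb)]
  exact card_filter_le _ _

lemma card_filter_adj_and_adj_le {d : V → ℕ} {a a' b : V} (hab : a ≠ b) (haa : a ≠ a')
    (ha : 1 ≤ d a) (hb : 1 ≤ d b) :
    #{G ∈ graphsWithDegrees d | G.Adj a b ∧ G.Adj a' b} ≤
      #{G ∈ graphsWithDegrees (reduceDegrees d a b) | G.Adj a' b} := by
  refine card_le_card_of_injOn (fun G => symmDiff G (SimpleGraph.edge a b)) ?_ ?_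
  · intro G hG
    simp only [coe_filter, Set.mem_ofPred_eq, mem_graphsWithDegrees] at hG ⊢
    have hn : ¬ (symmDiff G (SimpleGraph.edge a b)).Adj a b := by
      rw [adj_symmDiff, SimpleGraph.edge_adj]; grind
    refine ⟨fun v => ?_, ?_⟩
    · have := degree_symmDiff_edge hab hn v
      rw [symmDiff_symmDiff_cancel_right, hG.1 v, eq_reduceDegrees_add hab ha hb v] at this
      omega
    · rw [adj_symmDiff, SimpleGraph.edge_adj]; grind
  · intro G _ G' _ h
    exact symmDiff_left_injective _ h

lemma card_graphsWithDegrees_of_le_one (m : ℕ) : ∀ {d : V → ℕ}, (∀ v, d v ≤ 1) →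
    ∑ v, d v = 2 * m → #(graphsWithDegrees d) = oddFactorial m := by
  induction m with
  | zero =>
    intro d _ hs
    have hd : ∀ v, d v = 0 := by simpa using hs
    rw [show oddFactorial 0 = 1 from rfl, card_eq_one]
    refine ⟨⊥, ?_⟩
    ext G
    simp only [mem_graphsWithDegrees, mem_singleton, hd]
    constructor
    · intro h
      ext u v
      simp only [SimpleGraph.bot_adj, iff_false]
      intro huv
      have := h u
      rw [degree_eq_card_filter, card_eq_zero] at this
      have h2 : v ∈ ({w | G.Adj u w} : Finset V) := by simpa using huv
      simp [this] at h2
    · rintro rfl v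
      simp
  | succ m ih =>
    intro d hd hs
    obtain ⟨v, hv⟩ : ∃ v, d v = 1 := by
      by_contra! h
      have : ∑ v, d v = 0 := sum_eq_zero fun v _ => by have := hd v; have := h v; omega
      omega
    have h1 := sum_card_filter_adj d v
    rw [hv, one_mul] at h1
    have h2 : ∀ b, #{G ∈ graphsWithDegrees d | G.Adj v b}
        = (d b - if b = v then 1 else 0) * oddFactorial m := by
      intro b
      by_cases hbv : b = v
      · subst hbv; simp [hv]
      simp only [hbv, if_false, Nat.sub_zero]
      rcases Nat.eq_zero_or_pos (d b) with hb | hb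
      · rw [hb, zero_mul, card_eq_zero, filter_eq_empty_iff]
        intro G hG hadj
        have := pos_of_adj hG hadj.symm
        omega
      · have hb1 : d b = 1 := by have := hd b; omega
        rw [card_filter_adj_eq (Ne.symm hbv)
          (eq_reduceDegrees_add (Ne.symm hbv) (by omega) (by omega)), hb1, one_mul,
          filter_true_of_mem, ih]
        · intro w
          have := hd w
          unfold reduceDegrees; omega
        · have := sum_reduceDegrees (d := d) (Ne.symm hbv) (by omega) (by omega)
          omega
        · intro G hG hadj
          have := pos_of_adj hG hadj
          simp [reduceDegrees, hv] at this
    rw [← h1, sum_congr rfl fun b _ => h2 b, ← sum_mul, oddFactorial_succ]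
    congr 1
    have h3 : ∑ b, (d b - if b = v then 1 else 0) + ∑ b, (if b = v then 1 else 0) = ∑ b, d b := by
      rw [← sum_add_distrib]
      refine sum_congr rfl fun b _ => ?_
      split_ifs with h
      · subst h; omega
      · omega
    simp at h3
    omega

lemma sum_splitDegrees (d : V → ℕ) (a : V) (φ : ℕ → ℕ) :
    ∑ o, φ (splitDegrees d a o) + φ (d a) = φ 1 + φ (d a - 1) + ∑ v, φ (d v) := by
  rw [Fintype.sum_option, ← add_sum_erase univ _ (mem_univ a),
    ← add_sum_erase univ (fun v => φ (d v)) (mem_univ a)]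
  have : ∑ x ∈ univ.erase a, φ (splitDegrees d a (some x)) = ∑ x ∈ univ.erase a, φ (d x) :=
    sum_congr rfl fun x hx => by simp [splitDegrees, ne_of_mem_erase hx]
  rw [this]
  simp [splitDegrees]
  ring

lemma prod_factorial_splitDegrees {d : V → ℕ} {a : V} (ha : 1 ≤ d a) :
    (∏ o, (splitDegrees d a o).factorial) * d a = ∏ v, (d v).factorial := by
  rw [Fintype.prod_option, ← mul_prod_erase univ _ (mem_univ a),
    ← mul_prod_erase univ (fun v => (d v).factorial) (mem_univ a)]
  have : ∏ x ∈ univ.erase a, (splitDegrees d a (some x)).factorial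
      = ∏ x ∈ univ.erase a, (d x).factorial :=
    prod_congr rfl fun x hx => by simp [splitDegrees, ne_of_mem_erase hx]
  rw [this, ← Nat.mul_factorial_pred (n := d a) (by omega)]
  simp [splitDegrees]
  ring

/-- Induction on degree sequences with fixed sum: split a vertex of degree at least two. -/
lemma degree_split_induction {motive : ∀ (V : Type) [Fintype V], (V → ℕ) → Prop}
    (base : ∀ (V : Type) [Fintype V] (d : V → ℕ), (∀ v, d v ≤ 1) → motive V d)
    (step : ∀ (V : Type) [Fintype V] (d : V → ℕ) (a : V), 2 ≤ d a →
      motive (Option V) (splitDegrees d a) → motive V d)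
    (V : Type) [Fintype V] (d : V → ℕ) : motive V d := by
  suffices ∀ (e : ℕ) (V : Type) [Fintype V] (d : V → ℕ), ∑ v, (d v - 1) = e → motive V d from
    this _ V d rfl
  intro e
  induction e with
  | zero =>
    intro V _ d h
    refine base V d fun v => ?_
    have := (sum_eq_zero_iff.1 h) v (mem_univ v)
    omega
  | succ e ih =>
    intro V _ d h
    obtain ⟨a, ha⟩ : ∃ a, 2 ≤ d a := by
      by_contra! hc
      have : ∑ v, (d v - 1) = 0 := sum_eq_zero fun v _ => by have := hc v; omega
      omega
    refine step V d a ha (ih _ _ ?_)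
    have := sum_splitDegrees d a (fun k => k - 1)
    omega

lemma splitDegrees_le {V : Type} {d : V → ℕ} {a : V} {D : ℕ} (hD : 1 ≤ D) (h : ∀ v, d v ≤ D)
    (o : Option V) : splitDegrees d a o ≤ D := by
  cases o with
  | none => exact hD
  | some v =>
    have := h v
    simp only [splitDegrees]
    split_ifs <;> omega

lemma sum_splitDegrees_eq {d : V → ℕ} {a : V} (ha : 1 ≤ d a) :
    ∑ o, splitDegrees d a o = ∑ v, d v := by
  have := sum_splitDegrees d a id
  simp only [id] at this
  omega

lemma sum_choose_splitDegrees {d : V → ℕ} {a : V} (ha : 1 ≤ d a) :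
    ∑ v, d v * (d v - 1) =
      ∑ o, splitDegrees d a o * (splitDegrees d a o - 1) + 2 * (d a - 1) := by
  have := sum_splitDegrees d a (fun k => k * (k - 1))
  obtain ⟨k, hk⟩ := Nat.exists_eq_add_of_le ha
  rw [hk] at this ⊢
  rcases k with _ | k
  · simpa using this.symm
  · simp only [Nat.add_sub_cancel_left, Nat.add_sub_cancel, Nat.sub_self, mul_zero] at this ⊢
    nlinarith

lemma card_mul_prod_factorial_le (V : Type) [Fintype V] (d : V → ℕ) : ∀ (m : ℕ),
    ∑ v, d v = 2 * m → #(graphsWithDegrees d) * ∏ v, (d v).factorial ≤ oddFactorial m := by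
  refine degree_split_induction (motive := fun V _ d => ∀ m, ∑ v, d v = 2 * m →
    #(graphsWithDegrees d) * ∏ v, (d v).factorial ≤ oddFactorial m) ?_ ?_ V d
  · intro V _ d hd m hm
    rw [card_graphsWithDegrees_of_le_one m hd hm, prod_eq_one, mul_one]
    intro v _
    exact Nat.factorial_eq_one.2 (hd v)
  · intro V _ d a ha ih m hm
    have h1 := ih m (by rw [sum_splitDegrees_eq (by omega), hm])
    rw [← prod_factorial_splitDegrees (a := a) (by omega)]
    refine le_trans ?_ h1
    rw [mul_comm _ (d a), ← mul_assoc, mul_comm _ (d a), mul_card_graphsWithDegrees (by omega)]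
    exact Nat.mul_le_mul_right _ (card_le_card sdiff_subset)

lemma card_filter_adj_mul_prod_factorial_le {d : V → ℕ} {m : ℕ} {a b : V} (hab : a ≠ b)
    (hm : ∑ v, d v = 2 * (m + 1)) :
    #{G ∈ graphsWithDegrees d | G.Adj a b} * ∏ v, (d v).factorial
      ≤ d a * d b * oddFactorial m := by
  by_cases ha : 1 ≤ d a
  swap
  · rw [filter_false_of_mem fun G hG h => ha (pos_of_adj hG h)]
    simp
  by_cases hb : 1 ≤ d b
  swap
  · rw [filter_false_of_mem fun G hG h => hb (pos_of_adj hG h.symm)]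
    simp
  rw [prod_factorial_reduceDegrees hab ha hb]
  have h1 := card_filter_adj_le hab ha hb
  have h2 := card_mul_prod_factorial_le V (reduceDegrees d a b) m (by
    have := sum_reduceDegrees hab ha hb
    omega)
  calc _ ≤ #(graphsWithDegrees (reduceDegrees d a b)) *
        (d a * d b * ∏ v, (reduceDegrees d a b v).factorial) := Nat.mul_le_mul_right _ h1
    _ = d a * d b * (#(graphsWithDegrees (reduceDegrees d a b)) *
        ∏ v, (reduceDegrees d a b v).factorial) := by ring
    _ ≤ _ := Nat.mul_le_mul_left _ h2

lemma card_filter_adj_and_adj_mul_prod_factorial_le {d : V → ℕ} {m : ℕ} {a ℓ b : V} (hab : a ≠ b)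
    (hlb : ℓ ≠ b) (hla : ℓ ≠ a) (hl : d ℓ = 1) (hm : ∑ v, d v = 2 * (m + 2)) :
    #{G ∈ graphsWithDegrees d | G.Adj ℓ b ∧ G.Adj a b} * ∏ v, (d v).factorial
      ≤ d a * (d b * (d b - 1)) * oddFactorial m := by
  by_cases hb : 1 ≤ d b
  swap
  · rw [filter_false_of_mem fun G hG h => hb (pos_of_adj hG h.1.symm)]
    simp
  rw [prod_factorial_reduceDegrees hlb (by omega) hb, hl, one_mul]
  have h1 := card_filter_adj_and_adj_le (d := d) (a' := a) hlb hla (by omega) hb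
  have h2 := card_filter_adj_mul_prod_factorial_le (d := reduceDegrees d ℓ b) (m := m) hab (by
    have := sum_reduceDegrees (d := d) hlb (by omega) hb
    omega)
  have ha' : reduceDegrees d ℓ b a = d a := by simp [reduceDegrees, Ne.symm hla, hab]
  have hb' : reduceDegrees d ℓ b b = d b - 1 := by simp [reduceDegrees, Ne.symm hlb]
  rw [ha', hb'] at h2
  calc _ ≤ #{G ∈ graphsWithDegrees (reduceDegrees d ℓ b) | G.Adj a b} *
        (d b * ∏ v, (reduceDegrees d ℓ b v).factorial) := Nat.mul_le_mul_right _ h1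
    _ = d b * (#{G ∈ graphsWithDegrees (reduceDegrees d ℓ b) | G.Adj a b} *
        ∏ v, (reduceDegrees d ℓ b v).factorial) := by ring
    _ ≤ d b * (d a * (d b - 1) * oddFactorial m) := Nat.mul_le_mul_left _ h2
    _ = _ := by ring

lemma card_mergeObstructed_le {d : V → ℕ} {m : ℕ} {a ℓ : V} (hla : ℓ ≠ a) (hl : d ℓ = 1)
    (hm : ∑ v, d v = 2 * (m + 2)) :
    #(mergeObstructed d ℓ a) * ∏ v, (d v).factorial ≤
      d a * oddFactorial (m + 1) + d a * (∑ b, d b * (d b - 1)) * oddFactorial m := by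
  have hsub : mergeObstructed d ℓ a ⊆ {G ∈ graphsWithDegrees d | G.Adj ℓ a} ∪
      univ.biUnion fun b => {G ∈ graphsWithDegrees d | G.Adj ℓ b ∧ G.Adj a b} := by
    intro G hG
    simp only [mergeObstructed, mem_filter] at hG
    simp only [mem_union, mem_filter, mem_biUnion, mem_univ, true_and]
    obtain ⟨hG, c, hc, rfl | hac⟩ := hG
    · exact Or.inl ⟨hG, hc⟩
    · exact Or.inr ⟨c, hG, hc, hac⟩
  have hcard := (card_le_card hsub).trans ((card_union_le _ _).trans
    (Nat.add_le_add_left card_biUnion_le _))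
  refine (Nat.mul_le_mul_right _ hcard).trans ?_
  rw [add_mul, sum_mul, mul_sum, sum_mul]
  refine Nat.add_le_add ?_ (sum_le_sum fun b _ => ?_)
  · have := card_filter_adj_mul_prod_factorial_le (d := d) (m := m + 1) hla hm
    rwa [hl, one_mul] at this
  · by_cases hab : a = b
    · subst hab; simp
    by_cases hlb : ℓ = b
    · subst hlb; simp
    exact card_filter_adj_and_adj_mul_prod_factorial_le hab hlb hla hl hm

lemma sum_mul_pred_le {d : V → ℕ} {D m : ℕ} (hD : ∀ v, d v ≤ D) (hm : ∑ v, d v = 2 * m) :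
    ∑ v, d v * (d v - 1) ≤ 2 * m * D := by
  rw [← hm, sum_mul]
  exact sum_le_sum fun v _ => Nat.mul_le_mul_left _ ((Nat.sub_le _ _).trans (hD v))

/-- First-moment lower bound for the number of graphs with given degrees. -/
lemma le_card_mul_prod_factorial {D m : ℕ} (hD1 : 1 ≤ D) (V : Type) [Fintype V] (d : V → ℕ) :
    (∀ v, d v ≤ D) → ∑ v, d v = 2 * (m + 2) →
    (oddFactorial (m + 2) : ℝ) * (1 - (∑ v, d v * (d v - 1) : ℕ) * (D + 1) / (2 * m + 1)) ≤
      #(graphsWithDegrees d) * (∏ v, (d v).factorial : ℕ) := by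
  refine degree_split_induction (motive := fun V _ d => (∀ v, d v ≤ D) →
    ∑ v, d v = 2 * (m + 2) →
    (oddFactorial (m + 2) : ℝ) * (1 - (∑ v, d v * (d v - 1) : ℕ) * (D + 1) / (2 * m + 1)) ≤
      #(graphsWithDegrees d) * (∏ v, (d v).factorial : ℕ)) ?_ ?_ V d
  · intro V _ d hd _ hm
    rw [card_graphsWithDegrees_of_le_one (m + 2) hd hm, prod_eq_one, Nat.cast_one]
    · refine mul_le_mul_of_nonneg_left ?_ (by positivity)
      have : (0 : ℝ) ≤ (∑ v, d v * (d v - 1) : ℕ) * (D + 1) / (2 * m + 1) := by positivity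
      linarith
    · intro v _
      exact Nat.factorial_eq_one.2 (hd v)
  · intro V _ d a ha ih hD hm
    have hm' : ∑ o, splitDegrees d a o = 2 * (m + 2) := by rw [sum_splitDegrees_eq (by omega), hm]
    have h1 := ih (splitDegrees_le hD1 hD) hm'
    have h2 := card_mergeObstructed_le (d := splitDegrees d a) (a := some a) (ℓ := none)
      (by simp) rfl hm'
    have h3 := sum_mul_pred_le (splitDegrees_le (a := a) hD1 hD) hm'
    have h4 := sum_choose_splitDegrees (d := d) (a := a) (by omega)
    have h5 := mul_card_graphsWithDegrees (d := d) (a := a) (by omega)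
    have h6 : mergeObstructed (splitDegrees d a) none (some a) ⊆
        graphsWithDegrees (splitDegrees d a) := mergeObstructed_subset _ _ _
    have h7 := card_sdiff_add_card_eq_card h6
    have h8 := prod_factorial_splitDegrees (d := d) (a := a) (by omega)
    have hk : splitDegrees d a (some a) = d a - 1 := by simp [splitDegrees]
    rw [hk] at h2
    generalize hA : #(graphsWithDegrees d) = A at *
    generalize #(graphsWithDegrees (splitDegrees d a)) = B at *
    generalize #(mergeObstructed (splitDegrees d a) none (some a)) = F at *
    generalize (∏ o, (splitDegrees d a o).factorial) = P at *
    generalize (∏ v, (d v).factorial) = Q at *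
    generalize (∑ o, splitDegrees d a o * (splitDegrees d a o - 1)) = M' at *
    generalize (∑ v, d v * (d v - 1)) = M at *
    rw [← h5] at h7
    obtain ⟨k, hk⟩ := Nat.exists_eq_add_of_le' (show 1 ≤ d a by omega)
    rw [hk] at h2 h4 h7 h8
    rw [Nat.add_sub_cancel] at h2 h4
    have e1 : oddFactorial (m + 1) = (2 * m + 1) * oddFactorial m := oddFactorial_succ m
    have e2 : oddFactorial (m + 2) = (2 * m + 3) * oddFactorial (m + 1) := by
      rw [oddFactorial_succ]; ring
    have h9 : (F : ℝ) * P ≤ oddFactorial (m + 2) * (2 * k * (D + 1) / (2 * m + 1)) := by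
      have : (F : ℝ) * P ≤ k * oddFactorial (m + 1) + k * M' * oddFactorial m := by
        exact_mod_cast h2
      refine this.trans ?_
      have h3' : (M' : ℝ) ≤ 2 * (m + 2) * D := by exact_mod_cast h3
      have hO : (0 : ℝ) ≤ oddFactorial m := by positivity
      rw [e2, e1, mul_div_assoc', le_div_iff₀ (by positivity)]
      push_cast
      have hk0 : (0 : ℝ) ≤ k * oddFactorial m := by positivity
      have hD1' : (1 : ℝ) ≤ D := by exact_mod_cast hD1
      have hm0 : (0 : ℝ) ≤ m := by positivity
      have key : ((2 * m + 1 : ℝ) + M') * (2 * m + 1) ≤ (2 * m + 3) * (2 * m + 1) * (2 * (D + 1)) := by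
        have : (2 * m + 1 : ℝ) + M' ≤ (2 * m + 3) * (2 * (D + 1)) := by nlinarith
        nlinarith
      nlinarith [mul_le_mul_of_nonneg_left key hk0]
    have e3 : (A : ℝ) * Q = B * P - F * P := by
      have h7' : ((k : ℝ) + 1) * A + F = B := by exact_mod_cast h7
      have h8' : (P : ℝ) * (k + 1) = Q := by exact_mod_cast h8
      rw [← h7', ← h8']; ring
    have e4 : (M : ℝ) = M' + 2 * k := by exact_mod_cast h4
    rw [e3, e4]
    have : (oddFactorial (m + 2) : ℝ) * (1 - (M' + 2 * k) * (D + 1) / (2 * m + 1)) =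
      oddFactorial (m + 2) * (1 - M' * (D + 1) / (2 * m + 1)) -
        oddFactorial (m + 2) * (2 * k * (D + 1) / (2 * m + 1)) := by ring
    rw [this]
    linarith

end CrudeBounds

section Switching

open Finset

/-- The `4`-cycle `v b y x`, as a simple graph. -/
def fourCycle {V : Type} (v b x y : V) : SimpleGraph V :=
  SimpleGraph.edge v b ⊔ SimpleGraph.edge b y ⊔ SimpleGraph.edge y x ⊔ SimpleGraph.edge x v

lemma fourCycle_adj {V : Type} {v b x y s t : V} : (fourCycle v b x y).Adj s t ↔
    s ≠ t ∧ ((s = v ∧ t = b) ∨ (s = b ∧ t = v) ∨ (s = b ∧ t = y) ∨ (s = y ∧ t = b) ∨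
      (s = y ∧ t = x) ∨ (s = x ∧ t = y) ∨ (s = x ∧ t = v) ∨ (s = v ∧ t = x)) := by
  simp only [fourCycle, SimpleGraph.sup_adj, SimpleGraph.edge_adj]
  tauto

lemma fourCycle_swap {V : Type} (v b x y : V) : fourCycle v x b y = fourCycle v b x y := by
  ext s t
  simp only [fourCycle_adj]
  tauto

/-- The edges `vb` and `xy` of `G` can be replaced by `vx` and `by`. -/
structure Switchable {V : Type} (G : SimpleGraph V) (v b x y : V) : Prop where
  adj_left : G.Adj v b
  adj_right : G.Adj x y
  ne_left : x ≠ v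
  ne_right : y ≠ b
  not_adj_left : ¬ G.Adj v x
  not_adj_right : ¬ G.Adj b y

/-- Replace the edges `vb` and `xy` of `G` by `vx` and `by`. -/
def switchGraph {V : Type} (G : SimpleGraph V) (v b x y : V) : SimpleGraph V :=
  symmDiff G (fourCycle v b x y)

lemma Switchable.distinct {V : Type} {G : SimpleGraph V} {v b x y : V} (h : Switchable G v b x y) :
    v ≠ b ∧ x ≠ y ∧ x ≠ b ∧ y ≠ v := by
  obtain ⟨h1, h2, h3, h4, h5, h6⟩ := h
  refine ⟨h1.ne, h2.ne, ?_, ?_⟩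
  · rintro rfl; exact h5 h1
  · rintro rfl; exact h6 h1.symm

lemma Switchable.switch {V : Type} {G : SimpleGraph V} {v b x y : V} (h : Switchable G v b x y) :
    Switchable (switchGraph G v b x y) v x b y := by
  obtain ⟨d1, d2, d3, d4⟩ := h.distinct
  obtain ⟨h1, h2, h3, h4, h5, h6⟩ := h
  have h7 := h1.symm
  have h8 := h2.symm
  constructor <;> (try simp only [switchGraph, adj_symmDiff, fourCycle_adj]) <;> grind

lemma switchGraph_switchGraph {V : Type} (G : SimpleGraph V) (v b x y : V) :
    switchGraph (switchGraph G v b x y) v x b y = G := by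
  simp [switchGraph, fourCycle_swap]

variable {V : Type} [Fintype V]

lemma degree_eq_of_exchange {G H : SimpleGraph V} {v p q : V} (hp : ¬ G.Adj v p) (hq : G.Adj v q)
    (h : ∀ u, H.Adj v u ↔ u = p ∨ (G.Adj v u ∧ u ≠ q)) : H.degree v = G.degree v := by
  rw [degree_eq_card_filter, degree_eq_card_filter]
  have hset : ({w | H.Adj v w} : Finset V) = insert p (({w | G.Adj v w} : Finset V).erase q) := by
    ext u; simp [h]; tauto
  rw [hset, card_insert_of_notMem (by simp [hp]), card_erase_of_mem (by simpa using hq)]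
  have : 0 < #{w | G.Adj v w} := card_pos.2 ⟨q, by simpa using hq⟩
  omega

lemma Switchable.degree_switch {G : SimpleGraph V} {v b x y : V} (h : Switchable G v b x y)
    (w : V) : (switchGraph G v b x y).degree w = G.degree w := by
  obtain ⟨d1, d2, d3, d4⟩ := h.distinct
  obtain ⟨h1, h2, h3, h4, h5, h6⟩ := h
  have h7 := h1.symm
  have h8 := h2.symm
  have h9 : ¬ G.Adj x v := fun h => h5 h.symm
  have h10 : ¬ G.Adj y b := fun h => h6 h.symm
  by_cases hwv : w = v
  · subst hwv
    refine degree_eq_of_exchange h5 h1 fun u => ?_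
    simp only [switchGraph, adj_symmDiff, fourCycle_adj]; grind
  by_cases hwb : w = b
  · subst hwb
    refine degree_eq_of_exchange h6 h1.symm fun u => ?_
    simp only [switchGraph, adj_symmDiff, fourCycle_adj]; grind
  by_cases hwx : w = x
  · subst hwx
    refine degree_eq_of_exchange (fun h => h5 h.symm) h2 fun u => ?_
    simp only [switchGraph, adj_symmDiff, fourCycle_adj]; grind
  by_cases hwy : w = y
  · subst hwy
    refine degree_eq_of_exchange (fun h => h6 h.symm) h2.symm fun u => ?_
    simp only [switchGraph, adj_symmDiff, fourCycle_adj]; grind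
  · rw [degree_eq_card_filter, degree_eq_card_filter]
    congr 1
    ext u
    simp only [mem_filter, mem_univ, true_and, switchGraph, adj_symmDiff, fourCycle_adj]
    grind

/-- The arcs `(x, y)` of `G` that can be switched with `vb`. -/
noncomputable def switchArcs (G : SimpleGraph V) (v b : V) : Finset (V × V) :=
  {p | Switchable G v b p.1 p.2}

/-- The arcs (ordered adjacent pairs) of `G`. -/
noncomputable def arcs (G : SimpleGraph V) : Finset (V × V) := {p | G.Adj p.1 p.2}

/-- The switching involution, as an identity between sums. -/
lemma sum_switch (d : V → ℕ) (v : V) (φ : SimpleGraph V → V → V → V → ℝ) :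
    ∑ G ∈ graphsWithDegrees d, ∑ b with G.Adj v b, ∑ p ∈ switchArcs G v b, φ G b p.1 p.2 =
    ∑ G ∈ graphsWithDegrees d, ∑ b with G.Adj v b, ∑ p ∈ switchArcs G v b,
      φ (switchGraph G v b p.1 p.2) p.1 b p.2 := by
  simp_rw [sum_sigma']
  have key : ∀ q ∈ (graphsWithDegrees d).sigma fun G => ({b | G.Adj v b} : Finset V).sigma fun b =>
      switchArcs G v b, (⟨switchGraph q.1 v q.2.1 q.2.2.1 q.2.2.2, q.2.2.1, (q.2.1, q.2.2.2)⟩ :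
        Σ _ : SimpleGraph V, Σ _ : V, V × V) ∈
      (graphsWithDegrees d).sigma fun G => ({b | G.Adj v b} : Finset V).sigma fun b =>
      switchArcs G v b := by
    rintro ⟨G, b, x, y⟩ hq
    simp only [mem_sigma, mem_filter, mem_univ, true_and, switchArcs, mem_graphsWithDegrees]
      at hq ⊢
    obtain ⟨h1, -, h3⟩ := hq
    exact ⟨fun w => by rw [h3.degree_switch, h1], h3.switch.adj_left, h3.switch⟩
  refine sum_nbij' (fun q => ⟨switchGraph q.1 v q.2.1 q.2.2.1 q.2.2.2, q.2.2.1, (q.2.1, q.2.2.2)⟩)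
    (fun q => ⟨switchGraph q.1 v q.2.1 q.2.2.1 q.2.2.2, q.2.2.1, (q.2.1, q.2.2.2)⟩) key key ?_ ?_ ?_
  · rintro ⟨G, b, x, y⟩ _
    simp [switchGraph_switchGraph]
  · rintro ⟨G, b, x, y⟩ _
    simp [switchGraph_switchGraph]
  · rintro ⟨G, b, x, y⟩ _
    simp [switchGraph_switchGraph]

lemma sum_arcs (G : SimpleGraph V) (f : V → V → ℝ) :
    ∑ p ∈ arcs G, f p.1 p.2 = ∑ x, ∑ y with G.Adj x y, f x y := by
  rw [arcs, sum_filter, Fintype.sum_prod_type]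
  simp_rw [sum_filter]

lemma card_arcs {d : V → ℕ} {G : SimpleGraph V} (hG : G ∈ graphsWithDegrees d) :
    (#(arcs G) : ℝ) = ∑ v, (d v : ℝ) := by
  have := sum_arcs G fun _ _ => (1 : ℝ)
  simp only [sum_const, nsmul_eq_mul, mul_one, ← degree_eq_card_filter] at this
  rw [this]
  exact sum_congr rfl fun v _ => by rw [mem_graphsWithDegrees.1 hG v]

lemma switchArcs_subset (G : SimpleGraph V) (v b : V) : switchArcs G v b ⊆ arcs G := by
  intro p hp
  simp only [switchArcs, arcs, mem_filter, mem_univ, true_and] at hp ⊢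
  exact hp.adj_right

lemma card_filter_arcs_fst_le {G : SimpleGraph V} {D : ℕ} (hD : ∀ v, G.degree v ≤ D)
    (s : Finset V) : #{p ∈ arcs G | p.1 ∈ s} ≤ #s * D := by
  have : {p ∈ arcs G | p.1 ∈ s} ⊆
      s.biUnion fun x => ({y | G.Adj x y} : Finset V).map ⟨fun y => (x, y), by intro; simp⟩ := by
    rintro ⟨x, y⟩ hp
    simp only [arcs, mem_filter, mem_univ, true_and] at hp
    simp only [mem_biUnion, mem_map, mem_filter, mem_univ, true_and]
    exact ⟨x, hp.2, y, hp.1, rfl⟩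
  refine (card_le_card this).trans (card_biUnion_le_card_mul _ _ _ fun x _ => ?_)
  rw [card_map, ← degree_eq_card_filter]
  exact hD x

lemma card_filter_arcs_snd_le {G : SimpleGraph V} {D : ℕ} (hD : ∀ v, G.degree v ≤ D)
    (s : Finset V) : #{p ∈ arcs G | p.2 ∈ s} ≤ #s * D := by
  refine le_trans (le_of_eq ?_) (card_filter_arcs_fst_le hD s)
  refine card_nbij' Prod.swap Prod.swap ?_ ?_ ?_ ?_
  · rintro ⟨x, y⟩ hp
    simp only [arcs, coe_filter, mem_filter, mem_univ, true_and, Set.mem_ofPred_eq, Prod.fst_swap, Prod.snd_swap] at hp ⊢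
    exact ⟨hp.1.symm, hp.2⟩
  · rintro ⟨x, y⟩ hp
    simp only [arcs, coe_filter, mem_filter, mem_univ, true_and, Set.mem_ofPred_eq, Prod.fst_swap, Prod.snd_swap] at hp ⊢
    exact ⟨hp.1.symm, hp.2⟩
  · intro p _; simp
  · intro p _; simp

lemma card_arcs_sdiff_switchArcs_le {G : SimpleGraph V} {D : ℕ} (hD1 : 1 ≤ D)
    (hD : ∀ v, G.degree v ≤ D) {v b : V} (h : G.Adj v b) :
    #(arcs G \ switchArcs G v b) ≤ 4 * D ^ 2 := by
  have hsub : arcs G \ switchArcs G v b ⊆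
      {p ∈ arcs G | p.1 ∈ insert v ({x | G.Adj v x} : Finset V)} ∪
      {p ∈ arcs G | p.2 ∈ insert b ({x | G.Adj b x} : Finset V)} := by
    rintro ⟨x, y⟩ hp
    simp only [mem_sdiff, arcs, switchArcs, mem_filter, mem_univ, true_and, mem_union,
      mem_insert] at hp ⊢
    by_contra hc
    exact hp.2 ⟨h, hp.1, by tauto, by tauto, by tauto, by tauto⟩
  have hins : ∀ w, #(insert w ({x | G.Adj w x} : Finset V)) ≤ D + 1 := fun w =>
    (card_insert_le _ _).trans (by rw [← degree_eq_card_filter]; have := hD w; omega)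
  calc _ ≤ _ := card_le_card hsub
    _ ≤ _ := card_union_le _ _
    _ ≤ (D + 1) * D + (D + 1) * D :=
      add_le_add ((card_filter_arcs_fst_le hD _).trans (Nat.mul_le_mul_right _ (hins v)))
        ((card_filter_arcs_snd_le hD _).trans (Nat.mul_le_mul_right _ (hins b)))
    _ ≤ _ := by nlinarith

lemma abs_sum_sub_sum_subset_le {α : Type} [DecidableEq α] {s t : Finset α} (hst : t ⊆ s) (f : α → ℝ) {B : ℝ}
    (hf : ∀ p ∈ s \ t, |f p| ≤ B) : |∑ p ∈ s, f p - ∑ p ∈ t, f p| ≤ #(s \ t) * B := by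
  have h0 : ∑ p ∈ s, f p - ∑ p ∈ t, f p = ∑ p ∈ s \ t, f p := by
    rw [← sum_sdiff hst]; ring
  rw [h0]
  exact (abs_sum_le_sum_abs _ _).trans ((sum_le_card_nsmul _ _ _ hf).trans (by simp))

end Switching

section SwitchingEstimates

open Finset

variable {V : Type} [Fintype V]

lemma abs_sum_arcs_sub_sum_switchArcs_le {d : V → ℕ} {D : ℕ} (hD1 : 1 ≤ D) (hD : ∀ v, d v ≤ D)
    (v : V) (φ : SimpleGraph V → V → V × V → ℝ) (β : SimpleGraph V → V → ℝ)
    (hβ : ∀ G b, 0 ≤ β G b)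
    (hφ : ∀ G ∈ graphsWithDegrees d, ∀ b, G.Adj v b →
      ∀ p ∈ arcs G \ switchArcs G v b, |φ G b p| ≤ β G b) :
    |∑ G ∈ graphsWithDegrees d, ∑ b with G.Adj v b, ∑ p ∈ arcs G, φ G b p -
      ∑ G ∈ graphsWithDegrees d, ∑ b with G.Adj v b, ∑ p ∈ switchArcs G v b, φ G b p| ≤
      4 * D ^ 2 * ∑ G ∈ graphsWithDegrees d, ∑ b with G.Adj v b, β G b := by
  rw [← sum_sub_distrib, mul_sum]
  refine (abs_sum_le_sum_abs _ _).trans (sum_le_sum fun G hG => ?_)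
  rw [← sum_sub_distrib, mul_sum]
  refine (abs_sum_le_sum_abs _ _).trans (sum_le_sum fun b hb => ?_)
  simp only [mem_filter, mem_univ, true_and] at hb
  refine (abs_sum_sub_sum_subset_le (switchArcs_subset G v b) _ (hφ G hG b hb)).trans ?_
  refine mul_le_mul_of_nonneg_right ?_ (hβ G b)
  exact_mod_cast card_arcs_sdiff_switchArcs_le hD1
    (fun w => by rw [mem_graphsWithDegrees.1 hG]; exact hD w) hb

lemma sum_neighbors_const {d : V → ℕ} {G : SimpleGraph V} (hG : G ∈ graphsWithDegrees d) (v : V)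
    (r : ℝ) : ∑ b with G.Adj v b, r = d v * r := by
  rw [sum_const, ← degree_eq_card_filter, mem_graphsWithDegrees.1 hG, nsmul_eq_mul]

lemma sum_arcs_fst {d : V → ℕ} {G : SimpleGraph V} (hG : G ∈ graphsWithDegrees d) (g : V → ℝ) :
    ∑ p ∈ arcs G, g p.1 = ∑ x, d x * g x := by
  rw [sum_arcs G fun x _ => g x]
  exact sum_congr rfl fun x _ => sum_neighbors_const hG x (g x)

/-- The neighbours of a vertex are nearly size-biased. -/
lemma abs_sum_neighbors_sub_le {d : V → ℕ} {D : ℕ} (hD1 : 1 ≤ D) (hD : ∀ v, d v ≤ D)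
    (v : V) (g : V → ℝ) {B : ℝ} (hB : 0 ≤ B) (hg : ∀ w, |g w| ≤ B) :
    |(∑ w, (d w : ℝ)) * ∑ G ∈ graphsWithDegrees d, ∑ b with G.Adj v b, g b -
      d v * (∑ w, d w * g w) * #(graphsWithDegrees d)| ≤
      8 * D ^ 2 * B * d v * #(graphsWithDegrees d) := by
  have h1 := abs_sum_arcs_sub_sum_switchArcs_le hD1 hD v (fun _ b _ => g b) (fun _ _ => B)
    (fun _ _ => hB) fun G _ b _ p _ => hg b
  have h2 := abs_sum_arcs_sub_sum_switchArcs_le hD1 hD v (fun _ _ p => g p.1) (fun _ _ => B)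
    (fun _ _ => hB) fun G _ b _ p _ => hg p.1
  have h3 := sum_switch d v fun _ b _ _ => g b
  rw [h3] at h1
  have e1 : ∑ G ∈ graphsWithDegrees d, ∑ b with G.Adj v b, ∑ p ∈ arcs G, g b =
      (∑ w, (d w : ℝ)) * ∑ G ∈ graphsWithDegrees d, ∑ b with G.Adj v b, g b := by
    simp_rw [mul_sum]
    refine sum_congr rfl fun G hG => sum_congr rfl fun b _ => ?_
    rw [sum_const, nsmul_eq_mul, card_arcs hG]
  have e2 : ∑ G ∈ graphsWithDegrees d, ∑ b with G.Adj v b, ∑ p ∈ arcs G, g p.1 =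
      d v * (∑ w, d w * g w) * #(graphsWithDegrees d) := by
    rw [sum_congr rfl fun G hG => by rw [sum_arcs_fst hG g, sum_neighbors_const hG v]]
    rw [sum_const, nsmul_eq_mul, mul_comm]
  have e3 : ∑ G ∈ graphsWithDegrees d, ∑ b with G.Adj v b, B =
      d v * B * #(graphsWithDegrees d) := by
    rw [sum_congr rfl fun G hG => sum_neighbors_const hG v B]
    rw [sum_const, nsmul_eq_mul, mul_comm]
  rw [e1, e3] at h1
  rw [e2, e3] at h2
  rw [abs_le] at h1 h2 ⊢
  constructor <;> linarith [h1.1, h1.2, h2.1, h2.2]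

/-- `c` is within distance `3` of `a`, along a path whose inner vertices avoid `ℓ`. -/
def IsNear {V : Type} (G : SimpleGraph V) (ℓ a c : V) : Prop :=
  ∃ p q, p ≠ ℓ ∧ q ≠ ℓ ∧ (p = a ∨ G.Adj a p) ∧ (q = p ∨ G.Adj p q) ∧ (c = q ∨ G.Adj q c)

lemma card_insert_neighbors_le {G : SimpleGraph V} {D : ℕ} (hD1 : 1 ≤ D) (hD : ∀ v, G.degree v ≤ D)
    (v : V) : #(insert v ({x | G.Adj v x} : Finset V)) ≤ 2 * D :=
  (card_insert_le _ _).trans (by rw [← degree_eq_card_filter]; have := hD v; omega)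

lemma card_isNear_le {G : SimpleGraph V} {D : ℕ} (hD1 : 1 ≤ D) (hD : ∀ v, G.degree v ≤ D)
    (ℓ a : V) : #{c | IsNear G ℓ a c} ≤ 8 * D ^ 3 := by
  have hsub : ({c | IsNear G ℓ a c} : Finset V) ⊆
      (insert a ({x | G.Adj a x} : Finset V)).biUnion fun p =>
        (insert p ({x | G.Adj p x} : Finset V)).biUnion fun q =>
          insert q ({x | G.Adj q x} : Finset V) := by
    intro c hc
    simp only [mem_filter, mem_univ, true_and] at hc
    obtain ⟨p, q, -, -, h1, h2, h3⟩ := hc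
    simp only [mem_biUnion, mem_insert, mem_filter, mem_univ, true_and]
    exact ⟨p, h1, q, h2, h3⟩
  refine (card_le_card hsub).trans ?_
  calc _ ≤ #(insert a ({x | G.Adj a x} : Finset V)) * (2 * D * (2 * D)) := by
        refine card_biUnion_le_card_mul _ _ _ fun p _ => ?_
        refine (card_biUnion_le_card_mul _ _ (2 * D) fun q _ =>
          card_insert_neighbors_le hD1 hD q).trans ?_
        exact Nat.mul_le_mul_right _ (card_insert_neighbors_le hD1 hD p)
    _ ≤ 2 * D * (2 * D * (2 * D)) := Nat.mul_le_mul_right _ (card_insert_neighbors_le hD1 hD a)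
    _ = _ := by ring

lemma Switchable.adj_switch_iff {V : Type} {G : SimpleGraph V} {v b x y s t : V}
    (h : Switchable G v b x y) (hs : s ≠ v) (hs' : s ≠ x) (ht : t ≠ v) (ht' : t ≠ x) :
    G.Adj s t → (switchGraph G v b x y).Adj s t := by
  obtain ⟨d1, d2, d3, d4⟩ := h.distinct
  obtain ⟨h1, h2, h3, h4, h5, h6⟩ := h
  have h10 : ¬ G.Adj y b := fun h => h6 h.symm
  intro hst
  simp only [switchGraph, adj_symmDiff, fourCycle_adj]
  grind

lemma Switchable.isNear_switch {V : Type} {G : SimpleGraph V} {ℓ a b x y : V}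
    (h : Switchable G ℓ b x y) (ha : a ≠ ℓ) (hb : IsNear G ℓ a b) (hx : ¬ IsNear G ℓ a x) :
    IsNear (switchGraph G ℓ b x y) ℓ a b := by
  have hbl : b ≠ ℓ := h.adj_left.ne'
  obtain ⟨p, q, hp, hq, h1, h2, h3⟩ := hb
  have hax : a ≠ x := by
    rintro rfl; exact hx ⟨a, a, ha, ha, Or.inl rfl, Or.inl rfl, Or.inl rfl⟩
  have hpx : p ≠ x := by
    rintro rfl; exact hx ⟨p, p, hp, hp, h1, Or.inl rfl, Or.inl rfl⟩
  have hqx : q ≠ x := by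
    rintro rfl; exact hx ⟨p, q, hp, hq, h1, h2, Or.inl rfl⟩
  have hbx : b ≠ x := by
    rintro rfl; exact hx ⟨p, q, hp, hq, h1, h2, h3⟩
  exact ⟨p, q, hp, hq, h1.imp_right (h.adj_switch_iff ha hax hp hpx),
    h2.imp_right (h.adj_switch_iff hp hpx hq hqx), h3.imp_right (h.adj_switch_iff hq hqx hbl hbx)⟩

/-- The number of graphs in which the neighbour of the leaf `ℓ` is close to `a`. -/
noncomputable def nearCount (d : V → ℕ) (ℓ a : V) : ℝ :=
  ∑ G ∈ graphsWithDegrees d, ∑ b with G.Adj ℓ b, if IsNear G ℓ a b then 1 else 0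

lemma mul_nearCount_le {d : V → ℕ} {D m : ℕ} (hD1 : 1 ≤ D) (hD : ∀ v, d v ≤ D) {ℓ a : V}
    (hla : a ≠ ℓ) (hl : d ℓ = 1) (hm : ∑ v, d v = 2 * m) (hDm : 12 * D ^ 4 ≤ m) :
    m * nearCount d ℓ a ≤ 8 * D ^ 4 * #(graphsWithDegrees d) := by
  have hsw := sum_switch d ℓ fun G b x _ => if IsNear G ℓ a b ∧ ¬ IsNear G ℓ a x then (1 : ℝ) else 0
  have hmr : ∑ v, (d v : ℝ) = 2 * m := by exact_mod_cast hm
  have hGD : ∀ G ∈ graphsWithDegrees d, ∀ v, G.degree v ≤ D := fun G hG v => by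
    rw [mem_graphsWithDegrees.1 hG]; exact hD v
  have hball : ∀ G ∈ graphsWithDegrees d,
      (#{p ∈ arcs G | p.1 ∈ ({c | IsNear G ℓ a c} : Finset V)} : ℝ) ≤ 8 * D ^ 4 := by
    intro G hG
    have := (card_filter_arcs_fst_le (hGD G hG) {c | IsNear G ℓ a c}).trans
      (Nat.mul_le_mul_right D (card_isNear_le hD1 (hGD G hG) ℓ a))
    have h2 : 8 * D ^ 3 * D = 8 * D ^ 4 := by ring
    rw [h2] at this
    exact_mod_cast this
  have hlow : m * nearCount d ℓ a ≤ ∑ G ∈ graphsWithDegrees d, ∑ b with G.Adj ℓ b,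
      ∑ p ∈ switchArcs G ℓ b, if IsNear G ℓ a b ∧ ¬ IsNear G ℓ a p.1 then (1 : ℝ) else 0 := by
    rw [nearCount, mul_sum]
    refine sum_le_sum fun G hG => ?_
    rw [mul_sum]
    refine sum_le_sum fun b hb => ?_
    simp only [mem_filter, mem_univ, true_and] at hb
    by_cases hn : IsNear G ℓ a b
    swap
    · simp [hn]
    simp only [hn, if_true, true_and, mul_one]
    rw [← sum_filter, sum_const, nsmul_eq_mul, mul_one]
    have hsub : arcs G ⊆ (({p ∈ switchArcs G ℓ b | ¬ IsNear G ℓ a p.1} ∪ (arcs G \ switchArcs G ℓ b)) ∪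
        {p ∈ arcs G | p.1 ∈ ({c | IsNear G ℓ a c} : Finset V)}) := by
      intro p hp
      simp only [mem_union, mem_filter, mem_sdiff, mem_univ, true_and]
      tauto
    have h1 : (#(arcs G) : ℝ) ≤ #{p ∈ switchArcs G ℓ b | ¬ IsNear G ℓ a p.1} +
        #(arcs G \ switchArcs G ℓ b) +
        #{p ∈ arcs G | p.1 ∈ ({c | IsNear G ℓ a c} : Finset V)} := by
      have := (card_le_card hsub).trans ((card_union_le _ _).trans
        (Nat.add_le_add_right (card_union_le _ _) _))
      exact_mod_cast this
    have h2 : (#(arcs G \ switchArcs G ℓ b) : ℝ) ≤ 4 * D ^ 2 := by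
      exact_mod_cast card_arcs_sdiff_switchArcs_le hD1 (hGD G hG) hb
    have h3 := hball G hG
    have h4 : (12 * D ^ 4 : ℝ) ≤ m := by exact_mod_cast hDm
    have h5 : (D ^ 2 : ℝ) ≤ D ^ 4 := by
      exact_mod_cast Nat.pow_le_pow_right hD1 (by norm_num)
    rw [card_arcs hG, hmr] at h1
    linarith
  refine hlow.trans ?_
  rw [hsw]
  calc _ ≤ ∑ G ∈ graphsWithDegrees d, ∑ b with G.Adj ℓ b, (8 * D ^ 4 : ℝ) := by
        refine sum_le_sum fun G hG => sum_le_sum fun b hb => ?_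
        refine le_trans ?_ (hball G hG)
        rw [← sum_filter, sum_const, nsmul_eq_mul, mul_one]
        refine Nat.cast_le.2 (card_le_card fun p hp => ?_)
        simp only [mem_filter, mem_univ, true_and, switchArcs, arcs] at hp ⊢
        obtain ⟨hs, h1, h2⟩ := hp
        refine ⟨hs.adj_right, ?_⟩
        have := hs.switch.isNear_switch hla h1 h2
        rwa [switchGraph_switchGraph] at this
    _ = _ := by
        rw [sum_congr rfl fun G hG => sum_neighbors_const hG ℓ _, sum_const, nsmul_eq_mul, hl]
        push_cast
        ring

end SwitchingEstimates

section MergeProbability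

open Finset

variable {V : Type} [Fintype V]

lemma sum_neighbors_of_unique {G : SimpleGraph V} {v c : V} (h : ∀ w, G.Adj v w ↔ w = c)
    (f : V → ℝ) : ∑ b with G.Adj v b, f b = f c := by
  have : ({b | G.Adj v b} : Finset V) = {c} := by ext w; simp [h]
  rw [this, sum_singleton]

lemma card_mergeObstructed_eq {d : V → ℕ} {ℓ : V} (hl : d ℓ = 1) (a : V) :
    (#(mergeObstructed d ℓ a) : ℝ) = ∑ G ∈ graphsWithDegrees d, ∑ b with G.Adj ℓ b,
      if b = a ∨ G.Adj a b then (1 : ℝ) else 0 := by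
  rw [mergeObstructed, card_filter, Nat.cast_sum]
  refine sum_congr rfl fun G hG => ?_
  obtain ⟨c, hc⟩ := exists_unique_adj_of_degree_one
    (G := G) (v := ℓ) (by rw [mem_graphsWithDegrees.1 hG, hl])
  rw [sum_neighbors_of_unique hc]
  simp only [hc, exists_eq_left]
  push_cast
  rfl

lemma sum_arcs_second_neighborhood {d : V → ℕ} {G : SimpleGraph V} (hG : G ∈ graphsWithDegrees d)
    (a : V) :
    ∑ p ∈ arcs G, (if p.1 = a ∨ (G.Adj a p.1 ∧ p.2 ≠ a) then (1 : ℝ) else 0) =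
      d a + ∑ b with G.Adj a b, ((d b : ℝ) - 1) := by
  rw [sum_arcs G fun x y => if x = a ∨ (G.Adj a x ∧ y ≠ a) then (1 : ℝ) else 0]
  have key : ∀ x, ∑ y with G.Adj x y, (if x = a ∨ (G.Adj a x ∧ y ≠ a) then (1 : ℝ) else 0) =
      (if x = a then (d a : ℝ) else 0) + if G.Adj a x then (d x : ℝ) - 1 else 0 := by
    intro x
    by_cases hxa : x = a
    · subst hxa
      simp [← degree_eq_card_filter, mem_graphsWithDegrees.1 hG]
    by_cases hax : G.Adj a x
    · simp only [hxa, hax, if_true, if_false, false_or, true_and, zero_add]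
      rw [← sum_filter, filter_filter, sum_const, nsmul_eq_mul, mul_one]
      have h1 : ({y | G.Adj x y ∧ y ≠ a} : Finset V) = ({y | G.Adj x y} : Finset V).erase a := by
        ext y; simp [and_comm]
      have hmem : a ∈ ({y | G.Adj x y} : Finset V) := by simpa using hax.symm
      rw [h1, card_erase_of_mem hmem, Nat.cast_sub (card_pos.2 ⟨a, hmem⟩),
        ← degree_eq_card_filter, mem_graphsWithDegrees.1 hG]
      simp
    · simp [hxa, hax]
  rw [sum_congr rfl fun x _ => key x, sum_add_distrib, ← sum_filter (fun x => G.Adj a x)]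
  simp

lemma abs_card_mergeObstructed_sub_le {d : V → ℕ} {D m : ℕ} (hD1 : 1 ≤ D) (hD : ∀ v, d v ≤ D)
    {ℓ a : V} (hla : a ≠ ℓ) (hl : d ℓ = 1) (hm : ∑ v, d v = 2 * m) :
    |2 * m * (#(mergeObstructed d ℓ a) : ℝ) - (d a * #(graphsWithDegrees d) +
      ∑ G ∈ graphsWithDegrees d, ∑ b with G.Adj a b, ((d b : ℝ) - 1))| ≤
      8 * D ^ 2 * nearCount d ℓ a := by
  have hmr : ∑ v, (d v : ℝ) = 2 * m := by exact_mod_cast hm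
  have hind : ∀ {P Q : Prop} [Decidable P] [Decidable Q], (P → Q) →
      |(if P then (1 : ℝ) else 0)| ≤ if Q then (1 : ℝ) else 0 := by
    intro P Q _ _ h
    by_cases hP : P
    · simp [hP, h hP]
    · simp only [hP, if_false, abs_zero]; split_ifs <;> norm_num
  have hnear : ∀ (G : SimpleGraph V) b, (b = a ∨ G.Adj a b) → IsNear G ℓ a b := fun G b hb =>
    ⟨a, a, hla, hla, Or.inl rfl, Or.inl rfl, hb⟩
  have h1 := abs_sum_arcs_sub_sum_switchArcs_le hD1 hD ℓ
    (fun G b _ => if b = a ∨ G.Adj a b then (1 : ℝ) else 0)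
    (fun G b => if IsNear G ℓ a b then 1 else 0) (fun _ _ => by positivity)
    fun G _ b _ p _ => hind (hnear G b)
  have h2 := abs_sum_arcs_sub_sum_switchArcs_le hD1 hD ℓ
    (fun G b p => if p.1 = a ∨ (G.Adj a p.1 ∧ p.2 ≠ a) then (1 : ℝ) else 0)
    (fun G b => if IsNear G ℓ a b then 1 else 0) (fun _ _ => by positivity)
    (by
      rintro G hG b hb ⟨x, y⟩ hp
      refine hind fun hx => ?_
      obtain ⟨c, hc⟩ := exists_unique_adj_of_degree_one
        (G := G) (v := ℓ) (by rw [mem_graphsWithDegrees.1 hG, hl])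
      obtain rfl : b = c := (hc b).1 hb
      simp only [mem_sdiff, arcs, switchArcs, mem_filter, mem_univ, true_and] at hp
      obtain ⟨hxy, hns⟩ := hp
      by_cases hxb : x = b
      · subst hxb
        exact hnear G x (hx.imp_right And.left)
      have hyl : y ≠ ℓ := by
        rintro rfl; exact hxb ((hc x).1 hxy.symm)
      have hxl : x ≠ ℓ := by
        rintro rfl
        have hya := (hc y).1 hxy
        rcases hx with hx | ⟨hx, hy⟩
        · exact hla hx.symm
        · exact hy (hya.trans ((hc a).1 hx.symm).symm)
      have hx' : x = a ∨ G.Adj a x := hx.imp_right And.left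
      by_cases hyb : y = b
      · subst hyb
        exact ⟨x, x, hxl, hxl, hx', Or.inl rfl, Or.inr hxy⟩
      by_cases hby : G.Adj b y
      · exact ⟨x, y, hxl, hyl, hx', Or.inr hxy, Or.inr hby.symm⟩
      · exact (hns ⟨hb, hxy, hxl, hyb, fun h => hxb ((hc x).1 h), hby⟩).elim)
  have h3 := sum_switch d ℓ fun G b _ _ => if b = a ∨ G.Adj a b then (1 : ℝ) else 0
  have h4 : ∑ G ∈ graphsWithDegrees d, ∑ b with G.Adj ℓ b, ∑ p ∈ switchArcs G ℓ b,
      (if p.1 = a ∨ (switchGraph G ℓ b p.1 p.2).Adj a p.1 then (1 : ℝ) else 0) =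
      ∑ G ∈ graphsWithDegrees d, ∑ b with G.Adj ℓ b, ∑ p ∈ switchArcs G ℓ b,
      (if p.1 = a ∨ (G.Adj a p.1 ∧ p.2 ≠ a) then (1 : ℝ) else 0) := by
    refine sum_congr rfl fun G hG => sum_congr rfl fun b _ => sum_congr rfl ?_
    rintro ⟨x, y⟩ hp
    simp only [switchArcs, mem_filter, mem_univ, true_and] at hp
    congr 1
    obtain ⟨d1, d2, d3, d4⟩ := hp.distinct
    obtain ⟨h1, h2, h3, h4, h5, h6⟩ := hp
    have h8 := h2.symm
    simp only [switchGraph, adj_symmDiff, fourCycle_adj]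
    grind
  rw [h3, h4] at h1
  have e1 : ∑ G ∈ graphsWithDegrees d, ∑ b with G.Adj ℓ b, ∑ p ∈ arcs G,
      (if b = a ∨ G.Adj a b then (1 : ℝ) else 0) = 2 * m * (#(mergeObstructed d ℓ a) : ℝ) := by
    rw [card_mergeObstructed_eq hl, ← hmr, mul_sum]
    refine sum_congr rfl fun G hG => ?_
    rw [mul_sum]
    refine sum_congr rfl fun b _ => ?_
    rw [sum_const, nsmul_eq_mul, card_arcs hG]
  have e2 : ∑ G ∈ graphsWithDegrees d, ∑ b with G.Adj ℓ b, ∑ p ∈ arcs G,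
      (if p.1 = a ∨ (G.Adj a p.1 ∧ p.2 ≠ a) then (1 : ℝ) else 0) =
      d a * #(graphsWithDegrees d) +
      ∑ G ∈ graphsWithDegrees d, ∑ b with G.Adj a b, ((d b : ℝ) - 1) := by
    rw [sum_congr rfl fun G hG => by
      rw [sum_arcs_second_neighborhood hG, sum_neighbors_const hG ℓ, hl, Nat.cast_one, one_mul]]
    rw [sum_add_distrib, sum_const, nsmul_eq_mul, mul_comm]
  rw [e1] at h1
  rw [e2] at h2
  rw [← nearCount] at h1 h2
  rw [abs_le] at h1 h2 ⊢
  constructor <;> linarith [h1.1, h1.2, h2.1, h2.2]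

/-- Second-order estimate for the probability that merging the leaf `ℓ` into `a` is obstructed. -/
lemma abs_mergeObstructed_prob_sub_le {d : V → ℕ} {D m : ℕ} (hD1 : 1 ≤ D) (hD : ∀ v, d v ≤ D)
    {ℓ a : V} (hla : a ≠ ℓ) (hl : d ℓ = 1) (hm : ∑ v, d v = 2 * m) (hDm : 12 * D ^ 4 ≤ m) :
    |(#(mergeObstructed d ℓ a) : ℝ) - (d a / (2 * m) +
      d a * (∑ v, d v * ((d v : ℝ) - 1)) / (2 * m) ^ 2) * (#(graphsWithDegrees d) : ℝ)| ≤
      (34 : ℝ) * D ^ 6 / m ^ 2 * (#(graphsWithDegrees d) : ℝ) := by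
  have hmr : ∑ v, (d v : ℝ) = 2 * m := by exact_mod_cast hm
  have hD1r : (1 : ℝ) ≤ D := by exact_mod_cast hD1
  have hmpos : (0 : ℝ) < m := by
    have : 0 < m := lt_of_lt_of_le (by positivity) hDm
    exact_mod_cast this
  set N : ℝ := (#(graphsWithDegrees d) : ℝ) with hN
  have hN0 : 0 ≤ N := by positivity
  have h1 := abs_card_mergeObstructed_sub_le hD1 hD hla hl hm
  have h2 := abs_sum_neighbors_sub_le hD1 hD a (fun b => (d b : ℝ) - 1) (B := D) (by positivity)
    (by
      intro w
      have : (d w : ℝ) ≤ D := by exact_mod_cast hD w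
      have h0 : (0 : ℝ) ≤ d w := by positivity
      rw [abs_le]; constructor <;> linarith)
  have h3 := mul_nearCount_le hD1 hD hla hl hm hDm
  rw [hmr, ← hN] at h2
  rw [← hN] at h1 h3
  set H := ∑ G ∈ graphsWithDegrees d, ∑ b with G.Adj a b, ((d b : ℝ) - 1)
  set M := ∑ v, d v * ((d v : ℝ) - 1)
  set F : ℝ := (#(mergeObstructed d ℓ a) : ℝ)
  set Q := nearCount d ℓ a
  have hda : (d a : ℝ) ≤ D := by exact_mod_cast hD a
  have e : F - (d a / (2 * m) + d a * M / (2 * m) ^ 2) * N =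
      (2 * m * (2 * m * F - (d a * N + H)) + (2 * m * H - d a * M * N)) / (2 * m) ^ 2 := by
    field_simp
    ring
  rw [e, abs_div, abs_of_pos (show (0 : ℝ) < (2 * m) ^ 2 by positivity), div_le_iff₀ (by positivity)]
  have e2 : 34 * (D : ℝ) ^ 6 / m ^ 2 * N * (2 * m) ^ 2 = 136 * D ^ 6 * N := by
    field_simp; ring
  rw [e2]
  refine (abs_add_le _ _).trans ?_
  rw [abs_mul, abs_of_pos (show (0 : ℝ) < 2 * m by positivity)]
  have h4 : 2 * (m : ℝ) * |2 * m * F - (d a * N + H)| ≤ 2 * m * (8 * D ^ 2 * Q) :=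
    mul_le_mul_of_nonneg_left h1 (by positivity)
  have h5 : 16 * (D : ℝ) ^ 2 * (m * Q) ≤ 16 * D ^ 2 * (8 * D ^ 4 * N) :=
    mul_le_mul_of_nonneg_left h3 (by positivity)
  have h6 : 8 * (D : ℝ) ^ 2 * D * d a * N ≤ 8 * D ^ 6 * N := by
    refine mul_le_mul_of_nonneg_right ?_ hN0
    calc 8 * (D : ℝ) ^ 2 * D * d a ≤ 8 * D ^ 2 * D * D := mul_le_mul_of_nonneg_left hda (by positivity)
      _ = 8 * D ^ 4 := by ring
      _ ≤ 8 * D ^ 6 := by gcongr; norm_num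
  nlinarith

end MergeProbability

section AsymptoticCount

open Finset

lemma cast_sum_mul_pred {V : Type} [Fintype V] (d : V → ℕ) :
    ((∑ v, d v * (d v - 1) : ℕ) : ℝ) = ∑ v, d v * ((d v : ℝ) - 1) := by
  push_cast
  refine sum_congr rfl fun v _ => ?_
  rcases Nat.eq_zero_or_pos (d v) with h | h
  · simp [h]
  · rw [Nat.cast_sub h, Nat.cast_one]

lemma sum_pred_splitDegrees {V : Type} [Fintype V] {d : V → ℕ} {a : V} (ha : 2 ≤ d a) :
    ∑ v, (d v - 1) = ∑ o, (splitDegrees d a o - 1) + 1 := by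
  have := sum_splitDegrees d a (fun k => k - 1)
  simp only [Nat.sub_self] at this
  omega

lemma neg_sub_two_mul_sq_le_log_one_sub {p : ℝ} (hp : p ≤ 1 / 2) :
    -p - 2 * p ^ 2 ≤ Real.log (1 - p) := by
  have h1 : 0 < 1 - p := by linarith
  refine le_trans ?_ (Real.one_sub_inv_le_log_of_pos h1)
  have : (1 - p)⁻¹ ≤ 1 + p + 2 * p ^ 2 := by
    rw [inv_le_iff_one_le_mul₀ h1]
    nlinarith [mul_nonneg (sq_nonneg p) (show (0 : ℝ) ≤ 1 - 2 * p by linarith)]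
  linarith

/-- The logarithmic correction of one splitting step. -/
lemma abs_log_one_sub_add_le {D m k M P : ℝ} (hD : 1 ≤ D) (hm : 100 * D ^ 4 ≤ m) (hk0 : 0 ≤ k)
    (hk : k ≤ D) (hM0 : 0 ≤ M) (hM : M ≤ 2 * m * D) (hP0 : 0 ≤ P)
    (hP : |P - (k / (2 * m) + k * M / (2 * m) ^ 2)| ≤ 34 * D ^ 6 / m ^ 2) :
    P < 1 ∧ |Real.log (1 - P) + (k / (2 * m) + k * M / (2 * m) ^ 2) + (k / (2 * m)) ^ 2| ≤
      40 * D ^ 6 / m ^ 2 := by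
  have hD4 : 1 ≤ D ^ 4 := one_le_pow₀ hD
  have hD2 : 1 ≤ D ^ 2 := one_le_pow₀ hD
  have hm0 : 0 < m := by linarith
  set Z := k / (2 * m) + k * M / (2 * m) ^ 2 with hZ
  set t := D ^ 2 / m with ht
  have ht0 : 0 < t := by positivity
  have hε : 34 * D ^ 6 / m ^ 2 = 34 * D ^ 2 * t ^ 2 := by rw [ht]; field_simp
  have hε' : 40 * D ^ 6 / m ^ 2 = 40 * D ^ 2 * t ^ 2 := by rw [ht]; field_simp
  have hD2t : D ^ 2 * t ≤ 1 / 100 := by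
    rw [ht, mul_div_assoc', div_le_iff₀ hm0]; nlinarith
  have ht1 : t ≤ 1 / 100 := by nlinarith
  have hδ : k / (2 * m) ≤ t / 2 := by
    rw [ht, div_div, mul_comm m, div_le_div_iff_of_pos_right (by positivity)]; nlinarith
  have hδ0 : 0 ≤ k / (2 * m) := by positivity
  have hZle : Z ≤ t := by
    have : k * M / (2 * m) ^ 2 ≤ t / 2 := by
      rw [ht, div_div, div_le_div_iff₀ (by positivity) (by positivity)]
      have : k * M ≤ D * (2 * m * D) := mul_le_mul hk hM hM0 (by linarith)
      nlinarith
    linarith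
  rw [hε] at hP
  rw [hε']
  have hP' := abs_le.1 hP
  have hPt : P ≤ 1.34 * t := by nlinarith
  have hPsmall : P ≤ 1 / 2 := by linarith
  have hl1 := neg_sub_two_mul_sq_le_log_one_sub hPsmall
  have hl2 : Real.log (1 - P) ≤ -P := by
    have := Real.log_le_sub_one_of_pos (show 0 < 1 - P by linarith)
    linarith
  have hP2 : 2 * P ^ 2 ≤ 4 * t ^ 2 := by nlinarith
  have hδ2 : (k / (2 * m)) ^ 2 ≤ t ^ 2 / 4 := by nlinarith
  have ht2 : t ^ 2 ≤ D ^ 2 * t ^ 2 := by nlinarith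
  refine ⟨by linarith, ?_⟩
  rw [abs_le]
  constructor <;> nlinarith [sq_nonneg (k / (2 * m))]

/-- The main asymptotic estimate for the number of graphs with given bounded degrees,
with error accumulated over splitting steps. -/
lemma abs_log_card_graphsWithDegrees_add_le_aux {D m : ℕ} (hD1 : 1 ≤ D) (hDm : 100 * D ^ 4 ≤ m)
    (V : Type) [Fintype V] (d : V → ℕ) : (∀ v, d v ≤ D) → ∑ v, d v = 2 * m →
    0 < #(graphsWithDegrees d) ∧
    |Real.log (#(graphsWithDegrees d) * (∏ v, (d v).factorial : ℕ) / oddFactorial m) +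
      ((∑ v, d v * ((d v : ℝ) - 1)) / (4 * m) + ((∑ v, d v * ((d v : ℝ) - 1)) / (4 * m)) ^ 2)| ≤
      ((∑ v, (d v - 1) : ℕ) : ℝ) * (40 * D ^ 6 / m ^ 2) := by
  have hD1r : (1 : ℝ) ≤ D := by exact_mod_cast hD1
  have hDmr : (100 : ℝ) * D ^ 4 ≤ m := by exact_mod_cast hDm
  have hm0 : (0 : ℝ) < m := lt_of_lt_of_le (by positivity) hDmr
  have hof : (0 : ℝ) < oddFactorial m := by exact_mod_cast oddFactorial_pos m
  refine degree_split_induction (motive := fun V _ d => (∀ v, d v ≤ D) → ∑ v, d v = 2 * m →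
    0 < #(graphsWithDegrees d) ∧
    |Real.log (#(graphsWithDegrees d) * (∏ v, (d v).factorial : ℕ) / oddFactorial m) +
      ((∑ v, d v * ((d v : ℝ) - 1)) / (4 * m) + ((∑ v, d v * ((d v : ℝ) - 1)) / (4 * m)) ^ 2)| ≤
      ((∑ v, (d v - 1) : ℕ) : ℝ) * (40 * D ^ 6 / m ^ 2)) ?_ ?_ V d
  · intro V _ d hd _ hm
    rw [card_graphsWithDegrees_of_le_one m hd hm]
    have h1 : ∏ v, (d v).factorial = 1 := prod_eq_one fun v _ => by
      have := hd v
      interval_cases d v <;> rfl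
    have h2 : ∑ v, d v * ((d v : ℝ) - 1) = 0 := sum_eq_zero fun v _ => by
      have := hd v
      interval_cases d v <;> simp
    refine ⟨oddFactorial_pos m, ?_⟩
    rw [h1, h2]
    simp only [Nat.cast_one, mul_one, div_self hof.ne', Real.log_one, zero_div, zero_add,
      ne_eq, OfNat.ofNat_ne_zero, not_false_eq_true, zero_pow, abs_zero]
    positivity
  · intro V _ d a ha ih hdD hm
    obtain ⟨hpos, ih⟩ := ih (splitDegrees_le hD1 hdD) ((sum_splitDegrees_eq (by omega)).trans hm)
    have hsum' := (sum_splitDegrees_eq (d := d) (a := a) (by omega)).trans hm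
    have hsplit_a : splitDegrees d a (some a) = d a - 1 := by simp [splitDegrees]
    have hP := abs_mergeObstructed_prob_sub_le (d := splitDegrees d a) hD1 (splitDegrees_le hD1 hdD)
      (ℓ := none) (a := some a) (by simp) rfl hsum' (by omega)
    have hmul := mul_card_graphsWithDegrees (d := d) (a := a) (by omega)
    rw [card_sdiff_of_subset (mergeObstructed_subset _ _ _)] at hmul
    have hFN := card_le_card (mergeObstructed_subset (splitDegrees d a) none (some a))
    have hmulr : (d a : ℝ) * #(graphsWithDegrees d) = #(graphsWithDegrees (splitDegrees d a)) -
        #(mergeObstructed (splitDegrees d a) none (some a)) := by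
      rw [← Nat.cast_sub hFN]; exact_mod_cast hmul
    have hprod : (∏ o, (splitDegrees d a o).factorial : ℕ) * (d a : ℝ) =
        (∏ v, (d v).factorial : ℕ) := by
      exact_mod_cast prod_factorial_splitDegrees (d := d) (a := a) (by omega)
    have hMrel : ∑ v, d v * ((d v : ℝ) - 1) =
        ∑ o, splitDegrees d a o * ((splitDegrees d a o : ℝ) - 1) + 2 * ((d a - 1 : ℕ) : ℝ) := by
      rw [← cast_sum_mul_pred, ← cast_sum_mul_pred]
      exact_mod_cast sum_choose_splitDegrees (d := d) (a := a) (by omega)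
    have hMle : ∑ o, splitDegrees d a o * ((splitDegrees d a o : ℝ) - 1) ≤ 2 * m * D := by
      rw [← cast_sum_mul_pred]
      exact_mod_cast sum_mul_pred_le (splitDegrees_le hD1 hdD) hsum'
    have hM0 : 0 ≤ ∑ o, splitDegrees d a o * ((splitDegrees d a o : ℝ) - 1) := by
      rw [← cast_sum_mul_pred]; positivity
    have hprodpos : (0 : ℝ) < (∏ o, (splitDegrees d a o).factorial : ℕ) := by
      exact_mod_cast prod_pos fun o _ => Nat.factorial_pos _
    rw [hMrel, sum_pred_splitDegrees ha]
    rw [hsplit_a] at hP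
    have hkD : ((d a - 1 : ℕ) : ℝ) ≤ D := by
      have := hdD a
      exact_mod_cast (by omega : d a - 1 ≤ D)
    set M := ∑ o, splitDegrees d a o * ((splitDegrees d a o : ℝ) - 1)
    set k : ℝ := ((d a - 1 : ℕ) : ℝ)
    set N' : ℝ := (#(graphsWithDegrees (splitDegrees d a)) : ℝ)
    set F' : ℝ := (#(mergeObstructed (splitDegrees d a) none (some a)) : ℝ)
    have hN' : 0 < N' := Nat.cast_pos.2 hpos
    have hP' : |F' / N' - (k / (2 * m) + k * M / (2 * m) ^ 2)| ≤ (34 : ℝ) * D ^ 6 / m ^ 2 := by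
      have : F' / N' - (k / (2 * m) + k * M / (2 * m) ^ 2) =
        (F' - (k / (2 * m) + k * M / (2 * m) ^ 2) * N') / N' := by
        rw [sub_div, mul_div_cancel_right₀ _ hN'.ne']
      rw [this, abs_div, abs_of_pos hN', div_le_iff₀ hN']
      exact hP
    obtain ⟨hlt, hlog⟩ := abs_log_one_sub_add_le hD1r hDmr (by positivity) hkD hM0 hMle
      (by positivity) hP'
    have hda0 : (0 : ℝ) < d a := by exact_mod_cast (by omega : 0 < d a)
    have hA : (#(graphsWithDegrees d) : ℝ) * (∏ v, (d v).factorial : ℕ) / oddFactorial m =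
        N' * (∏ o, (splitDegrees d a o).factorial : ℕ) / oddFactorial m * (1 - F' / N') := by
      rw [← hprod]
      field_simp
      linear_combination hmulr
    have hsub : 0 < N' - F' := by
      rw [div_lt_one hN'] at hlt; linarith
    refine ⟨?_, ?_⟩
    · rw [← hmulr] at hsub
      have := pos_of_mul_pos_right hsub hda0.le
      exact_mod_cast this
    · rw [hA, Real.log_mul (by positivity) (by linarith)]
      have e : ∀ x y : ℝ, x + y + ((M + 2 * k) / (4 * m) + ((M + 2 * k) / (4 * m)) ^ 2) =
          (x + (M / (4 * m) + (M / (4 * m)) ^ 2)) +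
          (y + (k / (2 * m) + k * M / (2 * m) ^ 2) + (k / (2 * m)) ^ 2) := by
        intro x y; field_simp; ring
      rw [e]
      refine (abs_add_le _ _).trans ?_
      push_cast at ih ⊢
      linarith

/-- Asymptotic number of graphs with given bounded degrees. -/
lemma abs_log_card_graphsWithDegrees_add_le {V : Type} [Fintype V] {D m : ℕ} (hD1 : 1 ≤ D)
    (hDm : 100 * D ^ 4 ≤ m) {d : V → ℕ} (hd : ∀ v, d v ≤ D) (hm : ∑ v, d v = 2 * m) :
    0 < #(graphsWithDegrees d) ∧
    |Real.log (#(graphsWithDegrees d) * (∏ v, (d v).factorial : ℕ) / oddFactorial m) +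
      ((∑ v, d v * ((d v : ℝ) - 1)) / (4 * m) + ((∑ v, d v * ((d v : ℝ) - 1)) / (4 * m)) ^ 2)| ≤
      (80 : ℝ) * D ^ 6 / m := by
  obtain ⟨h1, h2⟩ := abs_log_card_graphsWithDegrees_add_le_aux hD1 hDm V d hd hm
  refine ⟨h1, h2.trans ?_⟩
  have hm0 : (0 : ℝ) < m := by
    have : 0 < m := lt_of_lt_of_le (by positivity) hDm
    exact_mod_cast this
  have h3 : ((∑ v, (d v - 1) : ℕ) : ℝ) ≤ 2 * m := by
    have : ∑ v, (d v - 1) ≤ 2 * m := hm ▸ sum_le_sum fun v _ => Nat.sub_le _ _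
    exact_mod_cast this
  calc _ ≤ (2 * m : ℝ) * (40 * D ^ 6 / m ^ 2) := mul_le_mul_of_nonneg_right h3 (by positivity)
    _ = _ := by field_simp; ring

end AsymptoticCount

section Trees

open Finset

/-- Attach the leaf `ℓ` to the vertex `i` of a graph on the other vertices. -/
def attachLeaf {V : Type} {ℓ : V} (T : SimpleGraph {v : V // v ≠ ℓ}) (i : {v : V // v ≠ ℓ}) :
    SimpleGraph V where
  Adj u v := (∃ hu hv, T.Adj ⟨u, hu⟩ ⟨v, hv⟩) ∨ (u = ℓ ∧ v = i) ∨ (u = i ∧ v = ℓ)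
  symm := ⟨by
    rintro u v (⟨hu, hv, h⟩ | h | h)
    · exact Or.inl ⟨hv, hu, h.symm⟩
    · exact Or.inr (Or.inr h.symm)
    · exact Or.inr (Or.inl h.symm)⟩
  loopless := ⟨by
    rintro u (⟨hu, hv, h⟩ | ⟨rfl, h⟩ | ⟨h, rfl⟩)
    · exact h.ne rfl
    · exact i.2 h.symm
    · exact i.2 h.symm⟩

lemma attachLeaf_adj_coe {V : Type} {ℓ : V} {T : SimpleGraph {v : V // v ≠ ℓ}}
    {i u v : {v : V // v ≠ ℓ}} : (attachLeaf T i).Adj u v ↔ T.Adj u v := by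
  constructor
  · rintro (⟨_, _, h⟩ | ⟨h, _⟩ | ⟨_, h⟩)
    · exact h
    · exact (u.2 h).elim
    · exact (v.2 h).elim
  · exact fun h => Or.inl ⟨u.2, v.2, h⟩

lemma attachLeaf_adj_leaf {V : Type} {ℓ : V} {T : SimpleGraph {v : V // v ≠ ℓ}}
    {i : {v : V // v ≠ ℓ}} {v : V} : (attachLeaf T i).Adj ℓ v ↔ v = i := by
  constructor
  · rintro (⟨h, _⟩ | ⟨_, h⟩ | ⟨h, _⟩)
    · exact (h rfl).elim
    · exact h
    · exact (i.2 h.symm).elim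
  · exact fun h => Or.inr (Or.inl ⟨rfl, h⟩)

lemma attachLeaf_comap {V : Type} {ℓ : V} {T : SimpleGraph V} {i : {v : V // v ≠ ℓ}}
    (h : ∀ w, T.Adj ℓ w ↔ w = i) : attachLeaf (T.comap Subtype.val) i = T := by
  ext u v
  by_cases hu : u = ℓ
  · subst hu
    rw [attachLeaf_adj_leaf, h]
  by_cases hv : v = ℓ
  · subst hv
    rw [SimpleGraph.adj_comm, attachLeaf_adj_leaf, SimpleGraph.adj_comm, h]
  · exact attachLeaf_adj_coe (u := ⟨u, hu⟩) (v := ⟨v, hv⟩)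

lemma comap_attachLeaf {V : Type} {ℓ : V} (T : SimpleGraph {v : V // v ≠ ℓ})
    (i : {v : V // v ≠ ℓ}) : (attachLeaf T i).comap Subtype.val = T := by
  ext u v
  exact attachLeaf_adj_coe

lemma connected_attachLeaf_iff {V : Type} {ℓ : V} {T : SimpleGraph {v : V // v ≠ ℓ}}
    {i : {v : V // v ≠ ℓ}} : (attachLeaf T i).Connected ↔ T.Connected := by
  have : Nonempty {v : V // v ≠ ℓ} := ⟨i⟩
  have : Nonempty V := ⟨ℓ⟩
  rw [SimpleGraph.connected_iff, SimpleGraph.connected_iff]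
  simp only [‹Nonempty V›, ‹Nonempty {v : V // v ≠ ℓ}›, and_true]
  constructor
  · intro h u v
    have huv := h u v
    rw [SimpleGraph.reachable_iff_reflTransGen] at huv ⊢
    have key := Relation.ReflTransGen.lift' (r := (attachLeaf T i).Adj) (p := T.Adj)
      (fun w : V => if hw : w ≠ ℓ then (⟨w, hw⟩ : {v : V // v ≠ ℓ}) else i) (by
        intro a b hab
        simp only [Function.onFun]
        by_cases ha : a = ℓ
        · subst ha
          rw [attachLeaf_adj_leaf] at hab
          subst hab
          simp [i.2, Relation.ReflTransGen.refl]
        by_cases hb : b = ℓ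
        · subst hb
          rw [SimpleGraph.adj_comm, attachLeaf_adj_leaf] at hab
          subst hab
          simp [i.2, Relation.ReflTransGen.refl]
        · simp only [ne_eq, ha, hb, not_false_eq_true, dite_true]
          exact Relation.ReflTransGen.single
            ((attachLeaf_adj_coe (u := ⟨a, ha⟩) (v := ⟨b, hb⟩)).1 hab)) _ _ huv
    simpa [Function.onFun, u.2, v.2] using key
  · intro h
    have hreach : ∀ v, (attachLeaf T i).Reachable i v := by
      intro v
      by_cases hv : v = ℓ
      · subst hv
        exact (attachLeaf_adj_leaf.2 rfl : (attachLeaf T i).Adj v i).symm.reachable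
      · exact (h i ⟨v, hv⟩).map
          (⟨Subtype.val, fun {a b} hab => attachLeaf_adj_coe.2 hab⟩ : T →g attachLeaf T i)
    exact fun u v => (hreach u).symm.trans (hreach v)

variable {V : Type} [Fintype V]

lemma degree_attachLeaf_leaf {ℓ : V} {T : SimpleGraph {v : V // v ≠ ℓ}} {i : {v : V // v ≠ ℓ}} :
    (attachLeaf T i).degree ℓ = 1 := by
  rw [degree_eq_card_filter, card_eq_one]
  exact ⟨i, by ext w; simp [attachLeaf_adj_leaf]⟩

lemma degree_attachLeaf_coe {ℓ : V} {T : SimpleGraph {v : V // v ≠ ℓ}} {i v : {v : V // v ≠ ℓ}} :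
    (attachLeaf T i).degree v = T.degree v + if v = i then 1 else 0 := by
  rw [← sum_indicator_adj, ← sum_indicator_adj, Fintype.sum_eq_add_sum_subtype_ne _ ℓ, add_comm]
  congr 1
  · exact sum_congr rfl fun w _ => by simp only [attachLeaf_adj_coe]
  · rw [SimpleGraph.adj_comm]
    simp only [attachLeaf_adj_leaf, Subtype.ext_iff]

/-- The connected graphs with prescribed degrees. -/
noncomputable def connectedGraphs (t : V → ℕ) : Finset (SimpleGraph V) :=
  {T ∈ graphsWithDegrees t | T.Connected}

lemma mem_connectedGraphs {t : V → ℕ} {T : SimpleGraph V} :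
    T ∈ connectedGraphs t ↔ (∀ v, T.degree v = t v) ∧ T.Connected := by
  simp [connectedGraphs, mem_graphsWithDegrees]

/-- The degrees left after removing the leaf `ℓ` attached to `i`. -/
noncomputable def pruneDegrees {V : Type} (t : V → ℕ) {ℓ : V} (i : {v : V // v ≠ ℓ}) :
    {v : V // v ≠ ℓ} → ℕ := fun w => t w - if w = i then 1 else 0

lemma card_connectedGraphs_leaf {t : V → ℕ} (ht : ∀ v, 1 ≤ t v) {ℓ : V} (hl : t ℓ = 1)
    (P : SimpleGraph V → Prop) :
    #{T ∈ connectedGraphs t | P T} =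
      ∑ i : {v : V // v ≠ ℓ}, #{T ∈ connectedGraphs (pruneDegrees t i) | P (attachLeaf T i)} := by
  rw [← card_sigma]
  symm
  refine card_bij (fun q _ => attachLeaf q.2 q.1) ?_ ?_ ?_
  · rintro ⟨i, T⟩ hq
    simp only [mem_sigma, mem_univ, true_and, mem_filter, mem_connectedGraphs] at hq ⊢
    obtain ⟨⟨h1, h2⟩, h3⟩ := hq
    refine ⟨⟨fun v => ?_, connected_attachLeaf_iff.2 h2⟩, h3⟩
    by_cases hv : v = ℓ
    · subst hv; rw [degree_attachLeaf_leaf, hl]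
    · have h4 := degree_attachLeaf_coe (T := T) (i := i) (v := ⟨v, hv⟩)
      rw [h1, pruneDegrees] at h4
      have := ht v
      simp only at h4
      rw [h4]
      split_ifs <;> omega
  · rintro ⟨i, T⟩ hq ⟨i', T'⟩ hq' h
    simp only at h
    have hi : i = i' := by
      apply Subtype.ext
      have := attachLeaf_adj_leaf (T := T) (i := i) (v := i)
      rw [h, attachLeaf_adj_leaf] at this
      exact this.2 rfl
    subst hi
    have : T = T' := by
      rw [← comap_attachLeaf T i, h, comap_attachLeaf]
    rw [this]
  · intro T hT
    simp only [mem_filter, mem_connectedGraphs] at hT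
    obtain ⟨⟨h1, h2⟩, h3⟩ := hT
    obtain ⟨c, hc⟩ := exists_unique_adj_of_degree_one (G := T) (v := ℓ) (by rw [h1, hl])
    have hcl : c ≠ ℓ := ((hc c).2 rfl).ne'
    have hT := attachLeaf_comap (T := T) (i := ⟨c, hcl⟩) hc
    refine ⟨⟨⟨c, hcl⟩, T.comap Subtype.val⟩, ?_, hT⟩
    simp only [mem_sigma, mem_univ, true_and, mem_filter, mem_connectedGraphs]
    rw [hT]
    refine ⟨⟨fun v => ?_, ?_⟩, h3⟩
    · have h4 := degree_attachLeaf_coe (T := T.comap Subtype.val) (i := ⟨c, hcl⟩) (v := v)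
      rw [hT, h1] at h4
      rw [pruneDegrees, h4]
      simp
    · rw [← hT] at h2
      exact connected_attachLeaf_iff.1 h2

end Trees

section TreeCounts

open Finset

variable {V : Type} [Fintype V]

lemma connectedGraphs_eq_empty [Nontrivial V] {t : V → ℕ} {v : V} (hv : t v = 0) :
    connectedGraphs t = ∅ := by
  refine eq_empty_of_forall_notMem fun T hT => ?_
  rw [mem_connectedGraphs] at hT
  have := hT.2.preconnected.degree_pos_of_nontrivial v
  rw [hT.1, hv] at this
  exact lt_irrefl _ this

lemma exists_eq_one_of_sum_lt {t : V → ℕ} (ht : ∀ v, 1 ≤ t v)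
    (hs : ∑ v, t v < 2 * Fintype.card V) : ∃ v, t v = 1 := by
  by_contra! h
  have h2 : ∀ v, 2 ≤ t v := fun v => by
    have := ht v
    have := h v
    omega
  have : ∑ _v : V, 2 ≤ ∑ v, t v := sum_le_sum fun v _ => h2 v
  simp only [sum_const, card_univ, smul_eq_mul] at this
  omega

lemma card_subtype_ne {n : ℕ} (ℓ : V) (hV : Fintype.card V = n + 1) :
    Fintype.card {v : V // v ≠ ℓ} = n := by
  simp [hV]

lemma sum_pruneDegrees {t : V → ℕ} {ℓ : V} (hl : t ℓ = 1) (i : {v : V // v ≠ ℓ})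
    (hi : 1 ≤ t i) : ∑ w, pruneDegrees t i w + 2 = ∑ v, t v := by
  rw [Fintype.sum_eq_add_sum_subtype_ne _ ℓ, hl]
  have : ∑ w : {v : V // v ≠ ℓ}, t w
      = ∑ w, pruneDegrees t i w + ∑ w : {v : V // v ≠ ℓ}, if w = i then 1 else 0 := by
    rw [← sum_add_distrib]
    refine sum_congr rfl fun w _ => ?_
    rw [pruneDegrees]
    split_ifs with h
    · subst h; omega
    · simp
  simp only [sum_ite_eq', mem_univ, if_true] at this
  omega

lemma prod_factorial_pruneDegrees {t : V → ℕ} {ℓ : V} (i : {v : V // v ≠ ℓ})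
    (hi : 2 ≤ t i) : ∏ w : {v : V // v ≠ ℓ}, (t w - 1).factorial
      = (t i - 1) * ∏ w, (pruneDegrees t i w - 1).factorial := by
  rw [← mul_prod_erase univ _ (mem_univ i),
    ← mul_prod_erase univ (fun w => (pruneDegrees t i w - 1).factorial) (mem_univ i), ← mul_assoc]
  congr 1
  · obtain ⟨k, hk⟩ := Nat.exists_eq_add_of_le' hi
    simp [pruneDegrees, hk, Nat.factorial_succ]
  · refine prod_congr rfl fun w hw => ?_
    rw [pruneDegrees, if_neg (ne_of_mem_erase hw)]
    rfl

lemma one_le_pruneDegrees {V : Type} {t : V → ℕ} (ht : ∀ v, 1 ≤ t v) {ℓ : V} (i : {v : V // v ≠ ℓ})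
    (hi : 2 ≤ t i) (w : {v : V // v ≠ ℓ}) : 1 ≤ pruneDegrees t i w := by
  have := ht w
  rw [pruneDegrees]
  split_ifs with h
  · subst h; omega
  · omega

lemma sum_pred_subtype {t : V → ℕ} (ht : ∀ v, 1 ≤ t v) {ℓ : V} (hl : t ℓ = 1) :
    ∑ w : {v : V // v ≠ ℓ}, (t w - 1) + Fintype.card V = ∑ v, t v := by
  have h : ∑ v, t v = ∑ v, (t v - 1) + ∑ _v : V, 1 := by
    rw [← sum_add_distrib]
    refine sum_congr rfl fun v _ => ?_
    have := ht v
    omega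
  rw [h, Fintype.sum_eq_add_sum_subtype_ne (fun v => t v - 1) ℓ, hl]
  simp

lemma connectedGraphs_eq_top {t : V → ℕ} (hV : Fintype.card V = 2) (ht : ∀ v, t v = 1) :
    connectedGraphs t = {⊤} := by
  have hcard : ∀ u : V, #(univ.erase u) = 1 := fun u => by
    rw [card_erase_of_mem (mem_univ u), card_univ, hV]
  ext T
  rw [mem_connectedGraphs, mem_singleton]
  constructor
  · rintro ⟨h, -⟩
    refine SimpleGraph.ext (funext fun u => funext fun v => propext ⟨fun h' => h'.ne, fun huv => ?_⟩)
    have hsub : ({w | T.Adj u w} : Finset V) ⊆ univ.erase u := by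
      intro w hw
      simp only [mem_filter, mem_univ, true_and] at hw
      exact mem_erase.2 ⟨hw.ne', mem_univ w⟩
    have heq := eq_of_subset_of_card_le hsub (by
      rw [← degree_eq_card_filter, hcard, h, ht])
    have : v ∈ univ.erase u := mem_erase.2 ⟨huv.symm, mem_univ v⟩
    rw [← heq] at this
    simpa using this
  · rintro rfl
    have : Nonempty V := Fintype.card_pos_iff.1 (by omega)
    refine ⟨fun v => ?_, SimpleGraph.connected_top⟩
    rw [degree_eq_card_filter, ht, ← hcard v]
    congr 1
    ext w
    simp [eq_comm]

/-- If the number of trees on one vertex less is known, so is the number of trees in which the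
leaf `ℓ` is attached to `i`. -/
lemma card_connectedGraphs_prune {n : ℕ} {t : V → ℕ} (ht : ∀ v, 1 ≤ t v) {ℓ : V}
    (hV : Fintype.card V = n + 3) (hs : ∑ v, t v = 2 * (n + 2)) (hl : t ℓ = 1)
    (i : {v : V // v ≠ ℓ})
    (ih : ∀ s : {v : V // v ≠ ℓ} → ℕ, (∀ v, 1 ≤ s v) → ∑ v, s v = 2 * (n + 1) →
      #(connectedGraphs s) * ∏ v, (s v - 1).factorial = n.factorial) :
    #(connectedGraphs (pruneDegrees t i)) * ∏ w : {v : V // v ≠ ℓ}, (t w - 1).factorial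
      = (t i - 1) * n.factorial := by
  have hcard := card_subtype_ne ℓ hV
  have : Nontrivial {v : V // v ≠ ℓ} := Fintype.one_lt_card_iff_nontrivial.1 (by omega)
  rcases Nat.lt_or_ge (t i) 2 with hi | hi
  · have hi1 : t i - 1 = 0 := by omega
    rw [connectedGraphs_eq_empty (v := i) (by simp [pruneDegrees, hi1]), hi1]
    simp
  · have := sum_pruneDegrees hl i (by omega)
    rw [prod_factorial_pruneDegrees i hi, ← ih _ (one_le_pruneDegrees ht i hi) (by omega)]
    ring

/-- The number of trees with a given degree sequence. -/
lemma card_connectedGraphs_mul_prod (n : ℕ) : ∀ (V : Type) [Fintype V] (t : V → ℕ),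
    Fintype.card V = n + 2 → (∀ v, 1 ≤ t v) → ∑ v, t v = 2 * (n + 1) →
      #(connectedGraphs t) * ∏ v, (t v - 1).factorial = n.factorial := by
  induction n with
  | zero =>
    intro V _ t hV ht hs
    have ht1 : ∀ v, t v = 1 := by
      by_contra! h
      obtain ⟨v, hv⟩ := h
      have : ∑ _v : V, 1 < ∑ v, t v :=
        sum_lt_sum (fun v _ => ht v) ⟨v, mem_univ v, lt_of_le_of_ne (ht v) hv.symm⟩
      simp [hV] at this
      omega
    rw [connectedGraphs_eq_top (by omega) ht1]
    simp [ht1]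
  | succ n ih =>
    intro V _ t hV ht hs
    obtain ⟨ℓ, hl⟩ := exists_eq_one_of_sum_lt ht (by omega)
    have h := card_connectedGraphs_leaf ht hl (fun _ => True)
    simp only [filter_true] at h
    rw [Fintype.prod_eq_mul_prod_subtype_ne _ ℓ, h, hl]
    have hsum := sum_pred_subtype ht hl
    calc _ = ∑ i : {v : V // v ≠ ℓ}, #(connectedGraphs (pruneDegrees t i)) *
            ∏ w : {v : V // v ≠ ℓ}, (t w - 1).factorial := by simp [sum_mul]
      _ = ∑ i : {v : V // v ≠ ℓ}, (t i - 1) * n.factorial := sum_congr rfl fun i _ =>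
          card_connectedGraphs_prune ht hV hs hl i fun s => ih _ s (card_subtype_ne ℓ hV)
      _ = _ := by
          rw [← sum_mul, Nat.factorial_succ]
          congr 1
          omega

/-- The number of trees with a given degree sequence that contain a given edge. -/
lemma card_connectedGraphs_filter_adj_mul_prod (n : ℕ) : ∀ (V : Type) [Fintype V] (t : V → ℕ)
    (j k : V), j ≠ k → Fintype.card V = n + 3 → (∀ v, 1 ≤ t v) → ∑ v, t v = 2 * (n + 2) →
      #{T ∈ connectedGraphs t | T.Adj j k} * ∏ v, (t v - 1).factorial
        = n.factorial * (t j + t k - 2) := by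
  have leafCase : ∀ (n : ℕ) (V : Type) [Fintype V] (t : V → ℕ)
    (j k : V), j ≠ k → Fintype.card V = n + 3 → (∀ v, 1 ≤ t v) → ∑ v, t v = 2 * (n + 2) →
      t j = 1 → #{T ∈ connectedGraphs t | T.Adj j k} * ∏ v, (t v - 1).factorial
        = n.factorial * (t j + t k - 2) := by
    intro n V _ t j k hjk hV ht hs hj
    rw [card_connectedGraphs_leaf ht hj, Fintype.prod_eq_mul_prod_subtype_ne _ j, hj]
    simp only [attachLeaf_adj_leaf]
    rw [sum_eq_single (⟨k, hjk.symm⟩ : {v : V // v ≠ j})]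
    · have := card_connectedGraphs_prune ht hV hs hj ⟨k, hjk.symm⟩ fun s =>
        card_connectedGraphs_mul_prod n _ s (card_subtype_ne j hV)
      simp only [filter_true, Nat.sub_self, Nat.factorial_zero, one_mul]
      rw [this, mul_comm]
      congr 1
      simp only
      omega
    · intro b _ hb
      have : k ≠ b := fun h => hb (Subtype.ext h.symm)
      simp [this]
    · simp
  induction n with
  | zero =>
    intro V _ t j k hjk hV ht hs
    by_cases hj : t j = 1
    · exact leafCase 0 V t j k hjk hV ht hs hj
    by_cases hk : t k = 1
    · have := leafCase 0 V t k j hjk.symm hV ht hs hk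
      simp only [SimpleGraph.adj_comm _ k j] at this
      rw [this, add_comm (t k)]
    obtain ⟨ℓ, hl⟩ := exists_eq_one_of_sum_lt ht (by omega)
    have hjl : j ≠ ℓ := fun h => hj (h ▸ hl)
    have hkl : k ≠ ℓ := fun h => hk (h ▸ hl)
    have h3 : ∑ v ∈ ({ℓ, j, k} : Finset V), t v ≤ ∑ v, t v :=
      sum_le_sum_of_subset (subset_univ _)
    rw [sum_insert (by simp [hjl.symm, hkl.symm]), sum_pair hjk] at h3
    have := ht j
    have := ht k
    omega
  | succ p ih =>
    intro V _ t j k hjk hV ht hs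
    by_cases hj : t j = 1
    · exact leafCase _ V t j k hjk hV ht hs hj
    by_cases hk : t k = 1
    · have := leafCase _ V t k j hjk.symm hV ht hs hk
      simp only [SimpleGraph.adj_comm _ k j] at this
      rw [this, add_comm (t k)]
    obtain ⟨ℓ, hl⟩ := exists_eq_one_of_sum_lt ht (by omega)
    have hjl : j ≠ ℓ := fun h => hj (h ▸ hl)
    have hkl : k ≠ ℓ := fun h => hk (h ▸ hl)
    have htj := ht j
    have htk := ht k
    have hcard := card_subtype_ne ℓ hV
    have hadj : ∀ i : {v : V // v ≠ ℓ},
        #{T ∈ connectedGraphs (pruneDegrees t i) | (attachLeaf T i).Adj j k} *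
          ∏ w : {v : V // v ≠ ℓ}, (t w - 1).factorial
        + p.factorial * ((if i = ⟨j, hjl⟩ then t j - 1 else 0) +
          (if i = ⟨k, hkl⟩ then t k - 1 else 0))
        = p.factorial * ((t i - 1) * (t j + t k - 2)) := by
      intro i
      have hiff : ∀ T : SimpleGraph {v : V // v ≠ ℓ},
          (attachLeaf T i).Adj j k ↔ T.Adj ⟨j, hjl⟩ ⟨k, hkl⟩ := fun T =>
        attachLeaf_adj_coe (u := ⟨j, hjl⟩) (v := ⟨k, hkl⟩)
      simp only [hiff]
      have hne : (⟨j, hjl⟩ : {v : V // v ≠ ℓ}) ≠ ⟨k, hkl⟩ := fun h => hjk (congrArg Subtype.val h)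
      rcases Nat.lt_or_ge (t i) 2 with hi | hi
      · have hi1 : t i - 1 = 0 := by omega
        have : Nontrivial {v : V // v ≠ ℓ} := Fintype.one_lt_card_iff_nontrivial.1 (by omega)
        have hij : i ≠ ⟨j, hjl⟩ := by rintro rfl; simp only at hi; omega
        have hik : i ≠ ⟨k, hkl⟩ := by rintro rfl; simp only at hi; omega
        rw [connectedGraphs_eq_empty (v := i) (by simp [pruneDegrees, hi1]), hi1]
        simp [hij, hik]
      · have hsum := sum_pruneDegrees hl i (by omega)
        have h := ih _ (pruneDegrees t i) ⟨j, hjl⟩ ⟨k, hkl⟩ hne hcard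
          (one_le_pruneDegrees ht i hi) (by omega)
        rw [prod_factorial_pruneDegrees i hi, mul_left_comm, h]
        rw [mul_left_comm, ← mul_add]
        congr 1
        simp only [pruneDegrees]
        by_cases hij : i = ⟨j, hjl⟩
        · have hik : i ≠ ⟨k, hkl⟩ := by rintro rfl; exact hne hij.symm
          subst hij
          simp only [hne, hne.symm, if_true, if_false]
          obtain ⟨a, ha⟩ : ∃ a, t j = a + 2 := ⟨t j - 2, by omega⟩
          obtain ⟨b, hb⟩ : ∃ b, t k = b + 2 := ⟨t k - 2, by omega⟩
          rw [ha, hb]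
          have e1 : a + 2 - 1 = a + 1 := by omega
          have e2 : a + 2 - 1 + (b + 2 - 0) - 2 = a + b + 1 := by omega
          have e3 : a + 2 + (b + 2) - 2 = a + b + 2 := by omega
          rw [e2, e1, e3]; ring
        by_cases hik : i = ⟨k, hkl⟩
        · subst hik
          simp only [hne, hne.symm, if_true, if_false]
          obtain ⟨a, ha⟩ : ∃ a, t j = a + 2 := ⟨t j - 2, by omega⟩
          obtain ⟨b, hb⟩ : ∃ b, t k = b + 2 := ⟨t k - 2, by omega⟩
          rw [ha, hb]
          have e1 : b + 2 - 1 = b + 1 := by omega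
          have e2 : a + 2 - 0 + (b + 1) - 2 = a + b + 1 := by omega
          have e3 : a + 2 + (b + 2) - 2 = a + b + 2 := by omega
          rw [e1, e2, e3]; ring
        · simp [hij, hik, Ne.symm hij, Ne.symm hik]
    have hsum := sum_pred_subtype ht hl
    have htot := sum_congr (rfl : (univ : Finset {v : V // v ≠ ℓ}) = univ) fun i _ => hadj i
    rw [sum_add_distrib, ← sum_mul, ← mul_sum, ← mul_sum, ← sum_mul, sum_add_distrib,
      sum_ite_eq', sum_ite_eq', ← card_connectedGraphs_leaf ht hl (fun T => T.Adj j k)] at htot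
    simp only [mem_univ, if_true] at htot
    rw [Fintype.prod_eq_mul_prod_subtype_ne _ ℓ, hl]
    have e1 : ∑ w : {v : V // v ≠ ℓ}, (t w - 1) = p + 2 := by omega
    rw [e1] at htot
    have e2 : t j - 1 + (t k - 1) = t j + t k - 2 := by omega
    rw [e2] at htot
    simp only [Nat.sub_self, Nat.factorial_zero, one_mul, Nat.factorial_succ]
    linarith

end TreeCounts

section Vandermonde

open Finset

variable {V : Type} [Fintype V]

/-- The functions bounded by `b` with total `r`. -/
noncomputable def boundedCompositions (b : V → ℕ) (r : ℕ) : Finset (V → ℕ) :=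
  {s ∈ Fintype.piFinset fun v => range (b v + 1) | ∑ v, s v = r}

lemma mem_boundedCompositions {b : V → ℕ} {r : ℕ} {s : V → ℕ} :
    s ∈ boundedCompositions b r ↔ (∀ v, s v ≤ b v) ∧ ∑ v, s v = r := by
  simp [boundedCompositions]

open Polynomial in
/-- Vandermonde's convolution with several summands. -/
lemma sum_prod_choose {a b : V → ℕ} (hab : ∀ v, a v ≤ b v) (r : ℕ) :
    ∑ s ∈ boundedCompositions b r, ∏ v, (a v).choose (s v) = (∑ v, a v).choose r := by
  have h1 : ∀ v, ((1 + X : ℕ[X]) ^ a v) = ∑ k ∈ range (b v + 1), monomial k ((a v).choose k) := by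
    intro v
    ext k
    rw [add_comm, coeff_X_add_one_pow, finsetSum_coeff]
    simp only [coeff_monomial, sum_ite_eq', mem_range]
    split_ifs with hk
    · rfl
    · exact Nat.choose_eq_zero_of_lt (by have := hab v; omega)
  have h2 : ((1 + X : ℕ[X]) ^ ∑ v, a v) =
      ∑ s ∈ Fintype.piFinset fun v => range (b v + 1),
        monomial (∑ v, s v) (∏ v, (a v).choose (s v)) := by
    rw [← prod_pow_eq_pow_sum, prod_congr rfl fun v _ => h1 v, prod_univ_sum]
    refine sum_congr rfl fun s _ => ?_
    simp only [← C_mul_X_pow_eq_monomial]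
    rw [prod_mul_distrib, prod_pow_eq_pow_sum, map_prod]
  have h3 := congrArg (fun p => p.coeff r) h2
  simp only [finsetSum_coeff, coeff_monomial] at h3
  rw [add_comm, coeff_X_add_one_pow, Nat.cast_id] at h3
  rw [h3, boundedCompositions, sum_filter]

/-- The second factorial moment of the multivariate hypergeometric distribution. -/
lemma sum_prod_choose_mul_moment (a : V → ℕ) (r : ℕ) :
    (∑ s ∈ boundedCompositions a r, (∏ v, (a v).choose (s v)) *
      ∑ i, (a i - s i) * (a i - s i - 1)) =
      (∑ i, a i * (a i - 1)) * (∑ v, a v - 2).choose r := by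
  simp only [mul_sum]
  rw [sum_comm, sum_mul]
  refine sum_congr rfl fun i _ => ?_
  rcases Nat.lt_or_ge (a i) 2 with hi | hi
  · have h0 : a i * (a i - 1) = 0 := by interval_cases h : a i <;> simp
    rw [h0, zero_mul]
    refine sum_eq_zero fun s hs => ?_
    have : a i - s i = 0 ∨ a i - s i - 1 = 0 := by omega
    rcases this with h | h <;> simp [h]
  · have hsum : ∑ v, Function.update a i (a i - 2) v = ∑ v, a v - 2 := by
      rw [sum_update_of_mem (mem_univ i), ← add_sum_erase univ a (mem_univ i),
        sdiff_singleton_eq_erase]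
      omega
    have hle : ∀ v, Function.update a i (a i - 2) v ≤ a v := by
      intro v
      by_cases h : v = i
      · subst h; simp
      · simp [h]
    rw [← hsum, ← sum_prod_choose hle, mul_sum]
    refine sum_congr rfl fun s hs => ?_
    rw [← mul_prod_erase univ _ (mem_univ i),
      ← mul_prod_erase univ (fun v => (Function.update a i (a i - 2) v).choose (s v))
        (mem_univ i)]
    have herase : ∏ v ∈ univ.erase i, (Function.update a i (a i - 2) v).choose (s v)
        = ∏ v ∈ univ.erase i, (a v).choose (s v) :=
      prod_congr rfl fun v hv => by rw [Function.update_of_ne (ne_of_mem_erase hv)]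
    rw [herase, Function.update_self]
    have key : (a i).choose (s i) * ((a i - s i) * (a i - s i - 1))
        = a i * (a i - 1) * (a i - 2).choose (s i) := by
      obtain ⟨k, hk⟩ := Nat.exists_eq_add_of_le' hi
      rw [hk]
      have e1 := Nat.choose_mul_succ_eq (k + 1) (s i)
      have e2 := Nat.choose_mul_succ_eq k (s i)
      have e3 : k + 2 - s i - 1 = k + 1 - s i := by omega
      have e4 : k + 2 - 1 = k + 1 := by omega
      have e5 : k + 2 - 2 = k := by omega
      rw [e3, e4, e5]
      calc (k + 2).choose (s i) * ((k + 2 - s i) * (k + 1 - s i))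
          = ((k + 1 + 1).choose (s i) * (k + 1 + 1 - s i)) * (k + 1 - s i) := by ring
        _ = (k + 2) * ((k + 1).choose (s i) * (k + 1 - s i)) := by rw [← e1]; ring
        _ = _ := by rw [← e2]; ring
    rw [mul_right_comm, key]
    ring

end Vandermonde

section SpanningTrees

open Finset

variable {V : Type} [Fintype V]

lemma degree_eq_add_of_disjoint {K T H : SimpleGraph V}
    (hK : ∀ j k, K.Adj j k ↔ T.Adj j k ∨ H.Adj j k) (h : ∀ j k, T.Adj j k → ¬ H.Adj j k) (v : V) :
    K.degree v = T.degree v + H.degree v := by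
  simp only [degree_eq_card_filter, hK]
  rw [filter_or, card_union_of_disjoint]
  rw [disjoint_filter]
  exact fun w _ => h v w

lemma isTree_iff_connected_and_sum_degree {n : ℕ} (hV : Fintype.card V = n + 1)
    {T : SimpleGraph V} : T.IsTree ↔ T.Connected ∧ ∑ v, T.degree v = 2 * n := by
  rw [SimpleGraph.isTree_iff_connected_and_card, Nat.card_eq_fintype_card,
    Nat.card_eq_fintype_card, hV, ← SimpleGraph.edgeFinset_card,
    T.sum_degrees_eq_twice_card_edges]
  constructor
  · rintro ⟨h1, h2⟩
    exact ⟨h1, by omega⟩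
  · rintro ⟨h1, h2⟩
    exact ⟨h1, by omega⟩

/-- A graph with a spanning tree consists of a tree and an edge-disjoint graph. -/
lemma sum_card_spanning_trees_eq {n : ℕ} (hV : Fintype.card V = n + 3) (a : V → ℕ) :
    ∑ G ∈ graphsWithDegrees fun v => a v + 1, #{T : SimpleGraph V | T ≤ G ∧ T.IsTree} =
      ∑ s ∈ boundedCompositions a (n + 1), ∑ T ∈ connectedGraphs fun v => s v + 1,
        #{H ∈ graphsWithDegrees fun v => a v - s v | ∀ j k, T.Adj j k → ¬ H.Adj j k} := by
  have : Nontrivial V := Fintype.one_lt_card_iff_nontrivial.1 (by omega)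
  simp only [← card_sigma]
  refine card_bij' (fun q _ => ⟨fun v => q.2.degree v - 1, q.2, q.1 \ q.2⟩)
    (fun q _ => ⟨q.2.1 ⊔ q.2.2, q.2.1⟩) ?_ ?_ ?_ ?_
  · rintro ⟨G, T⟩ h
    simp only [mem_sigma, mem_graphsWithDegrees, mem_filter, mem_univ, true_and,
      isTree_iff_connected_and_sum_degree (n := n + 2) hV, mem_boundedCompositions,
      mem_connectedGraphs] at h ⊢
    obtain ⟨hG, hTG, hT, hsum⟩ := h
    have hpos := fun v => hT.preconnected.degree_pos_of_nontrivial v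
    have hdeg := fun v => degree_eq_add_of_disjoint (K := G) (T := T) (H := G \ T)
      (fun j k => by
        have := @hTG j k
        simp only [SimpleGraph.sdiff_adj]
        tauto) (fun j k h1 h2 => h2.2 h1) v
    simp only [hG] at hdeg
    refine ⟨⟨fun v => ?_, ?_⟩, ⟨fun v => ?_, hT⟩, fun v => ?_, fun j k h1 h2 => h2.2 h1⟩
    · have := hdeg v
      omega
    · have : ∑ v, T.degree v = ∑ v, (T.degree v - 1) + ∑ _v : V, 1 := by
        rw [← sum_add_distrib]
        refine sum_congr rfl fun v _ => ?_
        have := hpos v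
        omega
      rw [hsum] at this
      simp only [sum_const, card_univ, hV, smul_eq_mul, mul_one] at this
      omega
    · have := hpos v
      omega
    · have := hpos v
      have := hdeg v
      omega
  · rintro ⟨s, T, H⟩ h
    simp only [mem_sigma, mem_graphsWithDegrees, mem_filter, mem_univ, true_and,
      isTree_iff_connected_and_sum_degree (n := n + 2) hV, mem_boundedCompositions,
      mem_connectedGraphs] at h ⊢
    obtain ⟨⟨hs, hsum⟩, ⟨hT, hc⟩, hH, hdisj⟩ := h
    refine ⟨fun v => ?_, le_sup_left, hc, ?_⟩
    · rw [degree_eq_add_of_disjoint (fun j k => SimpleGraph.sup_adj T H j k) hdisj, hT, hH]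
      have := hs v
      omega
    · rw [sum_congr rfl fun v _ => hT v, sum_add_distrib, hsum]
      simp only [sum_const, card_univ, hV, smul_eq_mul, mul_one]
      omega
  · rintro ⟨G, T⟩ h
    simp only [mem_sigma, mem_filter] at h
    simp only [sup_sdiff_cancel_right h.2.2.1]
  · rintro ⟨s, T, H⟩ h
    simp only [mem_sigma, mem_graphsWithDegrees, mem_filter, mem_connectedGraphs] at h
    obtain ⟨-, ⟨hT, -⟩, -, hdisj⟩ := h
    have e1 : (fun v => T.degree v - 1) = s := funext fun v => by rw [hT]; rfl
    have e2 : (T ⊔ H) \ T = H := by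
      ext j k
      simp only [SimpleGraph.sdiff_adj, SimpleGraph.sup_adj]
      have := hdisj j k
      tauto
    simp only [e1, e2]

end SpanningTrees

section SpanningTreeBounds

open Finset

variable {V : Type} [Fintype V]

lemma prod_choose_mul_prod_factorial {a s : V → ℕ} (hs : ∀ v, s v ≤ a v) :
    ∏ v, (a v).factorial =
      (∏ v, (a v).choose (s v)) * ((∏ v, (s v).factorial) * ∏ v, (a v - s v).factorial) := by
  rw [← prod_mul_distrib, ← prod_mul_distrib]
  exact prod_congr rfl fun v _ => by
    rw [← Nat.choose_mul_factorial_mul_factorial (hs v), mul_assoc]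

lemma sum_sub_of_mem_boundedCompositions {a s : V → ℕ} {r : ℕ}
    (hs : s ∈ boundedCompositions a r) : ∑ v, (a v - s v) = ∑ v, a v - r := by
  rw [mem_boundedCompositions] at hs
  rw [sum_tsub_distrib _ fun v _ => hs.1 v, hs.2]

lemma card_connectedGraphs_succ_mul_prod {n : ℕ} (hV : Fintype.card V = n + 3) {a s : V → ℕ}
    (hs : s ∈ boundedCompositions a (n + 1)) :
    #(connectedGraphs fun v => s v + 1) * ∏ v, (s v).factorial = (n + 1).factorial := by
  rw [mem_boundedCompositions] at hs
  have := card_connectedGraphs_mul_prod (n + 1) V (fun v => s v + 1) (by omega) (by simp) (by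
    rw [sum_add_distrib, hs.2]
    simp [hV]
    omega)
  simpa using this

/-- The configuration-model upper bound for the number of pairs of a graph and a spanning tree. -/
lemma sum_card_spanning_trees_mul_le {n X : ℕ} (hV : Fintype.card V = n + 3) {a : V → ℕ}
    (hsum : ∑ v, a v = n + 3 + 2 * X) :
    (∑ G ∈ graphsWithDegrees fun v => a v + 1, #{T : SimpleGraph V | T ≤ G ∧ T.IsTree}) *
        ∏ v, (a v).factorial ≤
      oddFactorial (X + 1) * (n + 1).factorial * (n + 3 + 2 * X).choose (n + 1) := by
  rw [sum_card_spanning_trees_eq hV, sum_mul, ← hsum, ← sum_prod_choose (fun v => le_refl (a v)),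
    mul_sum]
  refine sum_le_sum fun s hs => ?_
  have hu := sum_sub_of_mem_boundedCompositions hs
  have hle := card_mul_prod_factorial_le V (fun v => a v - s v) (X + 1) (by omega)
  rw [prod_choose_mul_prod_factorial (mem_boundedCompositions.1 hs).1,
    ← card_connectedGraphs_succ_mul_prod hV hs]
  calc _ ≤ (∑ T ∈ connectedGraphs fun v => s v + 1, #(graphsWithDegrees fun v => a v - s v)) *
        ((∏ v, (a v).choose (s v)) * ((∏ v, (s v).factorial) * ∏ v, (a v - s v).factorial)) := by
        gcongr
        exact filter_subset _ _
    _ = #(connectedGraphs fun v => s v + 1) * (∏ v, (s v).factorial) * (∏ v, (a v).choose (s v)) *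
        (#(graphsWithDegrees fun v => a v - s v) * ∏ v, (a v - s v).factorial) := by
        rw [sum_const, smul_eq_mul]; ring
    _ ≤ #(connectedGraphs fun v => s v + 1) * (∏ v, (s v).factorial) * (∏ v, (a v).choose (s v)) *
        oddFactorial (X + 1) := by gcongr
    _ = _ := by ring

lemma card_filter_not_disjoint_le {u : V → ℕ} {m : ℕ} (hu : ∑ v, u v = 2 * (m + 1))
    (T : SimpleGraph V) :
    #{H ∈ graphsWithDegrees u | ¬ ∀ j k, T.Adj j k → ¬ H.Adj j k} * ∏ v, (u v).factorial ≤
      ∑ j, ∑ k, (if T.Adj j k then 1 else 0) * (u j * u k * oddFactorial m) := by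
  have hsub : ({H ∈ graphsWithDegrees u | ¬ ∀ j k, T.Adj j k → ¬ H.Adj j k}) ⊆
      univ.biUnion fun j => univ.biUnion fun k =>
        {H ∈ graphsWithDegrees u | T.Adj j k ∧ H.Adj j k} := by
    intro H hH
    simp only [mem_filter, mem_biUnion, mem_univ, true_and] at hH ⊢
    push Not at hH
    obtain ⟨h1, j, k, h2, h3⟩ := hH
    exact ⟨j, k, h1, h2, h3⟩
  calc _ ≤ (∑ j, ∑ k, #{H ∈ graphsWithDegrees u | T.Adj j k ∧ H.Adj j k}) *
        ∏ v, (u v).factorial := by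
        gcongr
        refine (card_le_card hsub).trans (card_biUnion_le.trans (sum_le_sum fun j _ => ?_))
        exact card_biUnion_le
    _ = ∑ j, ∑ k, #{H ∈ graphsWithDegrees u | T.Adj j k ∧ H.Adj j k} *
        ∏ v, (u v).factorial := by simp only [sum_mul]
    _ ≤ _ := by
        refine sum_le_sum fun j _ => sum_le_sum fun k _ => ?_
        by_cases h : T.Adj j k
        · simp only [h, true_and, if_true, one_mul]
          exact card_filter_adj_mul_prod_factorial_le h.ne hu
        · simp [h]

/-- The total number of coincidences between the edges of a tree and those of a graph. -/
lemma sum_card_filter_not_disjoint_le {n X D : ℕ} (hV : Fintype.card V = n + 3) {a s : V → ℕ}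
    (hsum : ∑ v, a v = n + 3 + 2 * X) (hD : ∀ v, a v ≤ D)
    (hs : s ∈ boundedCompositions a (n + 1)) :
    (∑ T ∈ connectedGraphs fun v => s v + 1,
      #{H ∈ graphsWithDegrees fun v => a v - s v | ¬ ∀ j k, T.Adj j k → ¬ H.Adj j k}) *
        ((∏ v, (s v).factorial) * ∏ v, (a v - s v).factorial) ≤
      n.factorial * oddFactorial X * (2 * D * (2 * (X + 1)) ^ 2) := by
  have hu := sum_sub_of_mem_boundedCompositions hs
  have hu' : ∑ v, (a v - s v) = 2 * (X + 1) := by omega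
  obtain ⟨hsa, hss⟩ := mem_boundedCompositions.1 hs
  have hadj : ∀ j k, (∑ T ∈ connectedGraphs fun v => s v + 1, if T.Adj j k then 1 else 0) *
      ∏ v, (s v).factorial ≤ n.factorial * (s j + s k) := by
    intro j k
    by_cases hjk : j = k
    · subst hjk; simp
    · have := card_connectedGraphs_filter_adj_mul_prod n V (fun v => s v + 1) j k hjk hV (by simp)
        (by
          rw [sum_add_distrib, hss]
          simp [hV]
          omega)
      rw [← card_filter]
      simp only [add_tsub_cancel_right] at this
      rw [this]
      exact Nat.mul_le_mul_left _ (by omega)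
  set u : V → ℕ := fun v => a v - s v with hudef
  calc _ = (∑ T ∈ connectedGraphs fun v => s v + 1,
      #{H ∈ graphsWithDegrees u | ¬ ∀ j k, T.Adj j k → ¬ H.Adj j k} * ∏ v, (u v).factorial) *
        (∏ v, (s v).factorial) := by
        rw [← sum_mul]; ring
    _ ≤ (∑ T ∈ connectedGraphs fun v => s v + 1,
        ∑ j, ∑ k, (if T.Adj j k then 1 else 0) * (u j * u k * oddFactorial X)) *
        (∏ v, (s v).factorial) := by
        gcongr with T hT
        exact card_filter_not_disjoint_le hu' T
    _ = ∑ j, ∑ k, ((∑ T ∈ connectedGraphs fun v => s v + 1, if T.Adj j k then 1 else 0) *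
        ∏ v, (s v).factorial) * (u j * u k * oddFactorial X) := by
        rw [sum_comm, sum_mul]
        refine sum_congr rfl fun j _ => ?_
        rw [sum_comm, sum_mul]
        refine sum_congr rfl fun k _ => ?_
        rw [← sum_mul]
        ring
    _ ≤ ∑ j, ∑ k, (n.factorial * (D + D)) * (u j * u k * oddFactorial X) := by
        refine sum_le_sum fun j _ => sum_le_sum fun k _ => Nat.mul_le_mul_right _
          ((hadj j k).trans (Nat.mul_le_mul_left _ (add_le_add ?_ ?_)))
        · exact (hsa j).trans (hD j)
        · exact (hsa k).trans (hD k)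
    _ = _ := by
        rw [← hu', sq, sum_mul_sum, mul_sum, mul_sum]
        refine sum_congr rfl fun j _ => ?_
        rw [mul_sum, mul_sum]
        refine sum_congr rfl fun k _ => ?_
        ring

lemma le_sum_card_filter_disjoint_mul {n Y D : ℕ} (hV : Fintype.card V = n + 3) {a s : V → ℕ}
    (hsum : ∑ v, a v = n + 3 + 2 * (Y + 1)) (hD1 : 1 ≤ D) (hD : ∀ v, a v ≤ D)
    (hs : s ∈ boundedCompositions a (n + 1)) :
    ((n + 1).factorial : ℝ) * oddFactorial (Y + 2) *
        (1 - (∑ v, (a v - s v) * (a v - s v - 1) : ℕ) * (D + 1) / (2 * Y + 1)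
          - 8 * D * (Y + 2) ^ 2 / ((n + 1) * (2 * Y + 3))) ≤
      ((∑ T ∈ connectedGraphs fun v => s v + 1,
        #{H ∈ graphsWithDegrees fun v => a v - s v | ∀ j k, T.Adj j k → ¬ H.Adj j k} : ℕ) : ℝ) *
        ((∏ v, (s v).factorial : ℕ) * (∏ v, (a v - s v).factorial : ℕ)) := by
  have hu := sum_sub_of_mem_boundedCompositions hs
  have hlow := le_card_mul_prod_factorial (m := Y) hD1 V (fun v => a v - s v)
    (fun v => (Nat.sub_le _ _).trans (hD v)) (by omega)
  have htree := card_connectedGraphs_succ_mul_prod hV hs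
  have hbad := sum_card_filter_not_disjoint_le hV hsum hD hs
  have hsplit : (∑ T ∈ connectedGraphs fun v => s v + 1,
      #{H ∈ graphsWithDegrees fun v => a v - s v | ∀ j k, T.Adj j k → ¬ H.Adj j k}) +
      (∑ T ∈ connectedGraphs fun v => s v + 1,
      #{H ∈ graphsWithDegrees fun v => a v - s v | ¬ ∀ j k, T.Adj j k → ¬ H.Adj j k}) =
      #(connectedGraphs fun v => s v + 1) * #(graphsWithDegrees fun v => a v - s v) := by
    rw [← sum_add_distrib, ← smul_eq_mul, ← sum_const]
    exact sum_congr rfl fun T _ => card_filter_add_card_filter_not _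
  have hodd : (oddFactorial (Y + 2) : ℝ) = (2 * Y + 3) * oddFactorial (Y + 1) := by
    rw [oddFactorial_succ]
    push_cast
    ring
  have hfac : ((n + 1).factorial : ℝ) = (n + 1) * n.factorial := by
    rw [Nat.factorial_succ]
    push_cast
    ring
  generalize (∑ T ∈ connectedGraphs fun v => s v + 1,
      #{H ∈ graphsWithDegrees fun v => a v - s v | ∀ j k, T.Adj j k → ¬ H.Adj j k}) = good
    at hsplit ⊢
  generalize (∑ T ∈ connectedGraphs fun v => s v + 1,
      #{H ∈ graphsWithDegrees fun v => a v - s v | ¬ ∀ j k, T.Adj j k → ¬ H.Adj j k}) = bad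
    at hsplit hbad
  generalize (∑ v, (a v - s v) * (a v - s v - 1)) = M at hlow ⊢
  generalize (∏ v, (s v).factorial) = F at *
  generalize (∏ v, (a v - s v).factorial) = F' at *
  generalize #(connectedGraphs fun v => s v + 1) = t at *
  generalize #(graphsWithDegrees fun v => a v - s v) = g at *
  have h1 : (good : ℝ) + bad = t * g := by exact_mod_cast hsplit
  have h2 : (t : ℝ) * F = (n + 1).factorial := by exact_mod_cast htree
  have h3 : (bad : ℝ) * (F * F') ≤ n.factorial * oddFactorial (Y + 1) *
      (2 * D * (2 * (Y + 2)) ^ 2) := by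
    have := (Nat.cast_le (α := ℝ)).2 hbad
    push_cast at this
    exact this.trans (le_of_eq (by ring))
  have h4 : ((n + 1).factorial : ℝ) * oddFactorial (Y + 2) *
      (8 * D * (Y + 2) ^ 2 / ((n + 1) * (2 * Y + 3))) =
      n.factorial * oddFactorial (Y + 1) * (2 * D * (2 * (Y + 2)) ^ 2) := by
    rw [hodd, hfac]
    field_simp
    ring
  have h5 := mul_le_mul_of_nonneg_left hlow (Nat.cast_nonneg (α := ℝ) (n + 1).factorial)
  calc _ = ((n + 1).factorial : ℝ) * (oddFactorial (Y + 2) *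
        (1 - M * (D + 1) / (2 * Y + 1))) - ((n + 1).factorial : ℝ) * oddFactorial (Y + 2) *
      (8 * D * (Y + 2) ^ 2 / ((n + 1) * (2 * Y + 3))) := by ring
    _ ≤ ((n + 1).factorial : ℝ) * (g * F') - bad * (F * F') := by
        rw [h4]
        exact sub_le_sub h5 h3
    _ = _ := by
        rw [← h2]
        linear_combination (-(F * F' : ℝ)) * h1

lemma multiplicity_loss_le {D Y n S : ℝ} (hD : 1 ≤ D) (hY : 1 ≤ Y) (hn : 0 ≤ n)
    (hS : n + 1 ≤ S - 1) :
    (D + 1) / (2 * Y + 1) * (D * ((2 * Y + 4) * (2 * Y + 3)) / (S - 1)) ≤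
      10 * D ^ 2 * (Y + 1) / (n + 1) := by
  have h1 : D + 1 ≤ 2 * D := by linarith
  have h2 : (2 * Y + 4) * (2 * Y + 3) ≤ 5 * (Y + 1) * (2 * Y + 1) := by nlinarith
  have h3 : 0 < S - 1 := by linarith
  calc _ ≤ (2 * D) / (2 * Y + 1) * (D * (5 * (Y + 1) * (2 * Y + 1)) / (n + 1)) := by gcongr
    _ = _ := by field_simp; ring

lemma coincidence_loss_le {D Y n : ℝ} (hD : 1 ≤ D) (hY : 1 ≤ Y) (hn : 0 ≤ n) :
    8 * D * (Y + 2) ^ 2 / ((n + 1) * (2 * Y + 3)) ≤ 8 * D ^ 2 * (Y + 1) / (n + 1) := by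
  rw [div_le_div_iff₀ (by positivity) (by positivity)]
  have h1 : (Y + 2) ^ 2 ≤ (Y + 1) * (2 * Y + 3) := by nlinarith
  have h2 : D ≤ D ^ 2 := by nlinarith
  calc 8 * D * (Y + 2) ^ 2 * (n + 1) ≤ 8 * D ^ 2 * ((Y + 1) * (2 * Y + 3)) * (n + 1) := by
        gcongr
    _ = _ := by ring

lemma choose_sub_two_mul (n Y : ℕ) :
    (((n + 3 + 2 * (Y + 1) - 2).choose (n + 1) : ℕ) : ℝ) *
      ((n + 3 + 2 * (Y + 1) : ℕ) * ((n + 3 + 2 * (Y + 1) : ℕ) - 1)) =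
      (n + 3 + 2 * (Y + 1)).choose (n + 1) * ((2 * Y + 4) * (2 * Y + 3)) := by
  have e1 := Nat.choose_mul_succ_eq (n + 3 + 2 * Y) (n + 1)
  have e2 := Nat.choose_mul_succ_eq (n + 3 + 2 * Y + 1) (n + 1)
  have e3 : n + 3 + 2 * (Y + 1) - 2 = n + 3 + 2 * Y := by omega
  have e5 : n + 3 + 2 * Y + 1 - (n + 1) = 2 * Y + 3 := by omega
  have e6 : n + 3 + 2 * Y + 1 + 1 - (n + 1) = 2 * Y + 4 := by omega
  have e4 : n + 3 + 2 * (Y + 1) = n + 3 + 2 * Y + 1 + 1 := by ring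
  rw [e5] at e1
  rw [e6] at e2
  rw [e3, e4]
  have f1 := congrArg (Nat.cast (R := ℝ)) e1
  have f2 := congrArg (Nat.cast (R := ℝ)) e2
  push_cast at f1 f2 ⊢
  linear_combination (n + 3 + 2 * Y + 1 + 1 : ℝ) * f1 + (2 * Y + 3 : ℝ) * f2

/-- The matching lower bound for the number of pairs of a graph and a spanning tree. -/
lemma le_sum_card_spanning_trees_mul {n Y D : ℕ} (hV : Fintype.card V = n + 3) {a : V → ℕ}
    (hY : 1 ≤ Y) (hsum : ∑ v, a v = n + 3 + 2 * (Y + 1)) (hD1 : 1 ≤ D) (hD : ∀ v, a v ≤ D) :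
    (oddFactorial (Y + 2) * (n + 1).factorial * (n + 3 + 2 * (Y + 1)).choose (n + 1) : ℝ) *
        (1 - 18 * D ^ 2 * (Y + 1) / (n + 1)) ≤
      (∑ G ∈ graphsWithDegrees fun v => a v + 1, #{T : SimpleGraph V | T ≤ G ∧ T.IsTree} : ℕ) *
        (∏ v, (a v).factorial : ℕ) := by
  set S : ℕ := n + 3 + 2 * (Y + 1) with hS
  set K : ℝ := (n + 1).factorial * oddFactorial (Y + 2) with hK
  set ε : ℝ := 8 * D * (Y + 2) ^ 2 / ((n + 1) * (2 * Y + 3)) with hε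
  have hsumC := sum_prod_choose (fun v => le_refl (a v)) (n + 1)
  have hmom := sum_prod_choose_mul_moment a (n + 1)
  rw [hsum] at hsumC hmom
  have hMa : ∑ i, a i * (a i - 1) ≤ D * S := by
    rw [← hsum, mul_sum]
    refine sum_le_sum fun i _ => ?_
    rw [mul_comm]
    exact Nat.mul_le_mul_right _ ((Nat.sub_le _ _).trans (hD i))
  have hchoose : (((S - 2).choose (n + 1) : ℕ) : ℝ) * (S * (S - 1)) =
      S.choose (n + 1) * ((2 * Y + 4) * (2 * Y + 3)) := choose_sub_two_mul n Y
  have hterm : ∀ s ∈ boundedCompositions a (n + 1),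
      K * ((∏ v, (a v).choose (s v) : ℕ) * (1 - ε) - (D + 1) / (2 * Y + 1) *
        ((∏ v, (a v).choose (s v)) * ∑ v, (a v - s v) * (a v - s v - 1) : ℕ)) ≤
      ((∑ T ∈ connectedGraphs fun v => s v + 1,
        #{H ∈ graphsWithDegrees fun v => a v - s v | ∀ j k, T.Adj j k → ¬ H.Adj j k} : ℕ) : ℝ) *
        (∏ v, (a v).factorial : ℕ) := by
    intro s hs
    have h := mul_le_mul_of_nonneg_left (le_sum_card_filter_disjoint_mul hV hsum hD1 hD hs)
      (Nat.cast_nonneg (α := ℝ) (∏ v, (a v).choose (s v)))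
    rw [prod_choose_mul_prod_factorial (mem_boundedCompositions.1 hs).1, Nat.cast_mul,
      Nat.cast_mul, Nat.cast_mul]
    refine (le_of_eq ?_).trans (h.trans (le_of_eq ?_))
    · rw [hK, hε]; ring
    · ring
  have hall := sum_le_sum hterm
  rw [← mul_sum, sum_sub_distrib, ← sum_mul, ← mul_sum, ← sum_mul, ← Nat.cast_sum, ← Nat.cast_sum,
    ← Nat.cast_sum, hsumC, hmom, ← sum_card_spanning_trees_eq hV] at hall
  refine le_trans ?_ hall
  have hSpos : (0 : ℝ) < S - 1 := by
    have : (1 : ℝ) < S := by exact_mod_cast (by omega : 1 < S)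
    linarith
  have hS0 : (0 : ℝ) < S := by linarith
  have hY1 : (1 : ℝ) ≤ Y := by exact_mod_cast hY
  have hD1' : (1 : ℝ) ≤ D := by exact_mod_cast hD1
  have hn0 : (0 : ℝ) ≤ n := Nat.cast_nonneg n
  have hmom' : (((∑ i, a i * (a i - 1)) * (S - 2).choose (n + 1) : ℕ) : ℝ) ≤
      S.choose (n + 1) * (D * ((2 * Y + 4) * (2 * Y + 3)) / (S - 1)) := by
    have h1 : (((S - 2).choose (n + 1) : ℕ) : ℝ) =
        S.choose (n + 1) * ((2 * Y + 4) * (2 * Y + 3)) / (S * (S - 1)) := by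
      rw [eq_div_iff (by positivity), hchoose]
    rw [Nat.cast_mul, h1]
    have h2 : ((∑ i, a i * (a i - 1) : ℕ) : ℝ) ≤ D * S := by exact_mod_cast hMa
    calc _ ≤ (D * S : ℝ) * (S.choose (n + 1) * ((2 * Y + 4) * (2 * Y + 3)) / (S * (S - 1))) := by
          gcongr
      _ = _ := by field_simp
  have hSn : (n + 1 : ℝ) ≤ S - 1 := by
    have : ((n + 2 : ℕ) : ℝ) ≤ S := by exact_mod_cast (by omega : n + 2 ≤ S)
    push_cast at this
    linarith
  have hfirst := multiplicity_loss_le hD1' hY1 hn0 hSn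
  have hsecond : ε ≤ 8 * D ^ 2 * (Y + 1) / (n + 1) := coincidence_loss_le hD1' hY1 hn0
  have hcn : (0 : ℝ) ≤ S.choose (n + 1) := Nat.cast_nonneg _
  have hKn : 0 ≤ K := by positivity
  have h1 : (D + 1 : ℝ) / (2 * Y + 1) * ((∑ i, a i * (a i - 1)) * (S - 2).choose (n + 1) : ℕ) ≤
      S.choose (n + 1) * (10 * D ^ 2 * (Y + 1) / (n + 1)) := by
    calc _ ≤ (D + 1 : ℝ) / (2 * Y + 1) *
          (S.choose (n + 1) * (D * ((2 * Y + 4) * (2 * Y + 3)) / (S - 1))) := by gcongr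
      _ = S.choose (n + 1) *
          ((D + 1 : ℝ) / (2 * Y + 1) * (D * ((2 * Y + 4) * (2 * Y + 3)) / (S - 1))) := by ring
      _ ≤ _ := by gcongr
  have h2 := mul_le_mul_of_nonneg_left hsecond hcn
  calc _ = K * (S.choose (n + 1) * (1 - 18 * D ^ 2 * (Y + 1) / (n + 1))) := by rw [hK]; ring
    _ ≤ _ := by
        refine mul_le_mul_of_nonneg_left ?_ hKn
        have h3 : (S.choose (n + 1) : ℝ) * (1 - 18 * D ^ 2 * (Y + 1) / (n + 1)) =
          S.choose (n + 1) - S.choose (n + 1) * (8 * D ^ 2 * (Y + 1) / (n + 1)) -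
          S.choose (n + 1) * (10 * D ^ 2 * (Y + 1) / (n + 1)) := by ring
        rw [h3, mul_sub, mul_one]
        linarith

end SpanningTreeBounds

section Analysis

open Finset

open Filter Topology in
/-- Stirling's formula with an explicit error term. -/
lemma log_factorial_le_stirling {k : ℕ} (hk : 1 ≤ k) :
    Real.log k.factorial ≤
      k * Real.log k - k + Real.log k / 2 + Real.log (2 * Real.pi) / 2 + 1 / k := by
  have hmono : Monotone fun j : ℕ =>
      Real.log (Stirling.stirlingSeq (j + 1)) - 1 / ((j + 1 : ℕ) : ℝ) := by
    refine monotone_nat_of_le_succ fun j => ?_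
    have h := Stirling.log_stirlingSeq_sdiff_le (j + 1)
    have h2 : 1 / (12 * ((j + 1 : ℕ) : ℝ) * ((j + 1 : ℕ) + 1)) ≤
        1 / ((j + 1 : ℕ) : ℝ) - 1 / ((j + 1 + 1 : ℕ) : ℝ) := by
      push_cast
      rw [div_sub_div _ _ (by positivity) (by positivity),
        div_le_div_iff₀ (by positivity) (by positivity)]
      have : (0 : ℝ) ≤ j := Nat.cast_nonneg j
      nlinarith [mul_nonneg this this]
    linarith
  have hlim : Tendsto (fun j : ℕ =>
      Real.log (Stirling.stirlingSeq (j + 1)) - 1 / ((j + 1 : ℕ) : ℝ)) atTop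
      (𝓝 (Real.log √Real.pi - 0)) := by
    refine Tendsto.sub ?_ ?_
    · exact ((Real.continuousAt_log (by positivity)).tendsto.comp
        (Stirling.tendsto_stirlingSeq_sqrt_pi.comp (tendsto_add_atTop_nat 1)))
    · exact tendsto_one_div_atTop_nhds_zero_nat.comp (tendsto_add_atTop_nat 1)
  have h := hmono.ge_of_tendsto hlim (k - 1)
  obtain ⟨j, rfl⟩ := Nat.exists_eq_add_of_le' hk
  simp only [add_tsub_cancel_right, sub_zero] at h
  rw [Stirling.log_stirlingSeq_formula, Real.log_sqrt Real.pi_pos.le,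
    Real.log_mul (by norm_num) (by positivity), Real.log_div (by positivity) (by positivity),
    Real.log_exp] at h
  rw [Real.log_mul (by norm_num) Real.pi_pos.ne']
  linarith

/-- The main part of Stirling's formula. -/
noncomputable def stirlingMain (y : ℝ) : ℝ :=
  y * Real.log y - y + Real.log y / 2 + Real.log (2 * Real.pi) / 2

lemma abs_log_factorial_sub_le {k : ℕ} (hk : 1 ≤ k) :
    |Real.log k.factorial - stirlingMain k| ≤ 1 / k := by
  have h1 := log_factorial_le_stirling hk
  have h2 := Stirling.le_log_factorial_stirling (n := k) (by omega)
  have h3 : (0 : ℝ) ≤ 1 / k := by positivity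
  rw [stirlingMain, abs_le]
  constructor <;> linarith

lemma abs_one_add_mul_log_sub_le {y : ℝ} (h0 : 0 ≤ y) (h1 : y ≤ 1 / 2) :
    |(1 + y) * Real.log (1 + y) - (y + y ^ 2 / 2)| ≤ 4 * y ^ 3 := by
  have h := Real.abs_log_sub_add_sum_range_le (x := -y) (by rw [abs_neg, abs_of_nonneg h0]; linarith) 2
  rw [abs_neg, abs_of_nonneg h0, sub_neg_eq_add] at h
  simp only [sum_range_succ, range_zero, sum_empty] at h
  have h2 : y ^ (2 + 1) / (1 - y) ≤ 2 * y ^ 3 := by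
    rw [div_le_iff₀ (by linarith)]
    have h3 := mul_nonneg (pow_nonneg h0 3) (by linarith : 0 ≤ 1 - 2 * y)
    ring_nf at h3 ⊢
    linarith
  have h3 := abs_le.1 (h.trans h2)
  norm_num at h3
  obtain ⟨h4, h5⟩ := h3
  have h6 := mul_le_mul_of_nonneg_left h5 (by linarith : 0 ≤ 1 + y)
  have h7 := mul_le_mul_of_nonneg_left h4 (by linarith : 0 ≤ 1 + y)
  have h8 : y ^ 4 ≤ y ^ 3 / 2 := by nlinarith [pow_nonneg h0 3]
  have h9 : 0 ≤ y ^ 3 := pow_nonneg h0 3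
  rw [abs_le]
  constructor <;> nlinarith

/-- The asymptotic expansion of the product of factorials in the expected number of spanning
trees, with the leading terms separated. -/
lemma abs_stirlingMain_combination_le {n x : ℝ} (hx : 1 ≤ x) (hxn : 4 * x ≤ n) (hx2 : x ^ 2 ≤ n) :
    |n * Real.log 2 - Real.log 2 + stirlingMain (n + 2 * x) + stirlingMain (n + x)
        - stirlingMain x - Real.log x - stirlingMain (2 * n + 2 * x)
      - (-Real.log n + x * (1 - Real.log 2) + (3 / 2 + x) * (Real.log n - Real.log (2 * x))
        - n * Real.log 2 + 3 * x ^ 2 / (2 * n))| ≤ 36 * (x ^ 3 / n ^ 2) + 1 / x := by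
  have hn : 0 < n := by linarith
  have hx0 : 0 < x := by linarith
  have e1 : n + 2 * x = n * (1 + 2 * x / n) := by field_simp
  have e2 : n + x = n * (1 + x / n) := by field_simp
  have e3 : 2 * n + 2 * x = 2 * (n * (1 + x / n)) := by field_simp
  have p1 : 0 ≤ x / n := by positivity
  have p2 : 0 ≤ 2 * x / n := by positivity
  have q2 : 2 * x / n ≤ 1 / 2 := by rw [div_le_div_iff₀ hn (by norm_num)]; linarith
  have q1 : x / n ≤ 1 / 2 := by rw [div_le_div_iff₀ hn (by norm_num)]; linarith
  have l1 : Real.log (n + 2 * x) = Real.log n + Real.log (1 + 2 * x / n) := by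
    rw [e1, Real.log_mul hn.ne' (by positivity)]
  have l2 : Real.log (n + x) = Real.log n + Real.log (1 + x / n) := by
    rw [e2, Real.log_mul hn.ne' (by positivity)]
  have l3 : Real.log (2 * n + 2 * x) = Real.log 2 + (Real.log n + Real.log (1 + x / n)) := by
    rw [e3, Real.log_mul (by norm_num) (by positivity), Real.log_mul hn.ne' (by positivity)]
  have l4 : Real.log (2 * x) = Real.log 2 + Real.log x :=
    Real.log_mul (by norm_num) hx0.ne'
  have b1 := abs_le.1 (abs_one_add_mul_log_sub_le p2 q2)
  have b2 := abs_le.1 (abs_one_add_mul_log_sub_le p1 q1)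
  have b3 : Real.log (1 + 2 * x / n) ≤ 2 * x / n := by
    have := Real.log_le_sub_one_of_pos (by positivity : 0 < 1 + 2 * x / n)
    linarith
  have b4 : 0 ≤ Real.log (1 + 2 * x / n) := Real.log_nonneg (by linarith)
  have b5 : x / n ≤ 1 / x := by
    rw [div_le_div_iff₀ hn hx0]
    nlinarith
  have key : n * Real.log 2 - Real.log 2 + stirlingMain (n + 2 * x) + stirlingMain (n + x)
        - stirlingMain x - Real.log x - stirlingMain (2 * n + 2 * x)
      - (-Real.log n + x * (1 - Real.log 2) + (3 / 2 + x) * (Real.log n - Real.log (2 * x))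
        - n * Real.log 2 + 3 * x ^ 2 / (2 * n))
      = n * ((1 + 2 * x / n) * Real.log (1 + 2 * x / n) - (2 * x / n + (2 * x / n) ^ 2 / 2))
        - n * ((1 + x / n) * Real.log (1 + x / n) - (x / n + (x / n) ^ 2 / 2))
        + Real.log (1 + 2 * x / n) / 2 := by
    simp only [stirlingMain]
    rw [l1, l2, l3, l4]
    field_simp
    ring
  rw [key]
  have c1 : n * (4 * (2 * x / n) ^ 3) = 32 * (x ^ 3 / n ^ 2) := by field_simp; ring
  have c2 : n * (4 * (x / n) ^ 3) = 4 * (x ^ 3 / n ^ 2) := by field_simp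
  have d1 := mul_le_mul_of_nonneg_left b1.1 hn.le
  have d2 := mul_le_mul_of_nonneg_left b1.2 hn.le
  have d3 := mul_le_mul_of_nonneg_left b2.1 hn.le
  have d4 := mul_le_mul_of_nonneg_left b2.2 hn.le
  rw [mul_neg, c1] at d1
  rw [mul_neg, c2] at d3
  rw [c1] at d2
  rw [c2] at d4
  have h0 : 2 * x / n = 2 * (x / n) := by ring
  rw [abs_le]
  constructor <;> linarith

end Analysis

section ExpectedSpanningTrees

open Finset

lemma log_oddFactorial (m : ℕ) :
    Real.log (oddFactorial m) =
      Real.log (2 * m).factorial - m * Real.log 2 - Real.log m.factorial := by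
  have h : ((2 * m).factorial : ℝ) = 2 ^ m * m.factorial * oddFactorial m := by
    exact_mod_cast two_mul_factorial m
  have hpos : (0 : ℝ) < oddFactorial m := by exact_mod_cast oddFactorial_pos m
  rw [h, Real.log_mul (by positivity) hpos.ne', Real.log_mul (by positivity) (by positivity),
    Real.log_pow]
  ring

lemma log_oddFactorial_mul_choose (n X : ℕ) :
    Real.log (oddFactorial (X + 1) * (n + 1).factorial * (n + 3 + 2 * X).choose (n + 1)) =
      Real.log (n + 3 + 2 * X).factorial - (X + 1) * Real.log 2 - Real.log (X + 1).factorial := by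
  have h := Nat.choose_mul_factorial_mul_factorial (by omega : n + 1 ≤ n + 3 + 2 * X)
  have e : n + 3 + 2 * X - (n + 1) = 2 * (X + 1) := by omega
  rw [e] at h
  have h' : ((n + 3 + 2 * X).factorial : ℝ) =
      (n + 3 + 2 * X).choose (n + 1) * (n + 1).factorial * (2 * (X + 1)).factorial := by
    exact_mod_cast h.symm
  have hc : (0 : ℝ) < (n + 3 + 2 * X).choose (n + 1) := by
    exact_mod_cast Nat.choose_pos (by omega)
  have hpos : (0 : ℝ) < oddFactorial (X + 1) := by exact_mod_cast oddFactorial_pos (X + 1)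
  rw [h', Real.log_mul (by positivity) (by positivity), Real.log_mul (by positivity) (by positivity),
    Real.log_mul (by positivity) (by positivity), Real.log_mul (by positivity) (by positivity),
    log_oddFactorial]
  push_cast
  ring

lemma abs_log_le_of_one_sub_le {θ q : ℝ} (h0 : 0 ≤ θ) (h1 : θ ≤ 1 / 2) (hq : 1 - θ ≤ q)
    (hq1 : q ≤ 1) : |Real.log q| ≤ 2 * θ := by
  have hpos : 0 < 1 - θ := by linarith
  have h2 : -(2 * θ) ≤ Real.log (1 - θ) := by
    refine le_trans ?_ (Real.one_sub_inv_le_log_of_pos hpos)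
    have : (1 - θ)⁻¹ ≤ 1 + 2 * θ := by
      rw [inv_le_iff_one_le_mul₀ hpos]
      nlinarith
    linarith
  have h3 := Real.log_le_log hpos hq
  have h4 := Real.log_nonpos (by linarith) hq1
  rw [abs_le]
  constructor <;> linarith

variable {V : Type} [Fintype V]

/-- The logarithm of the expected number of spanning trees in terms of factorials. -/
lemma abs_log_expected_spanning_trees_sub_le {n Y D : ℕ} (hV : Fintype.card V = n + 3) {a : V → ℕ}
    (hY : 1 ≤ Y) (hsum : ∑ v, a v = n + 3 + 2 * (Y + 1)) (hD1 : 1 ≤ D) (hD : ∀ v, a v + 1 ≤ D)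
    (hDm : 100 * D ^ 4 ≤ n + 3 + (Y + 1))
    (hθ : (18 : ℝ) * D ^ 2 * (Y + 1) / (n + 1) ≤ 1 / 2) :
    0 < (∑ G ∈ graphsWithDegrees fun v => a v + 1, #{T : SimpleGraph V | T ≤ G ∧ T.IsTree}) ∧
    0 < #(graphsWithDegrees fun v => a v + 1) ∧
    |Real.log ((∑ G ∈ graphsWithDegrees fun v => a v + 1,
        #{T : SimpleGraph V | T ≤ G ∧ T.IsTree} : ℕ) / #(graphsWithDegrees fun v => a v + 1))
      - (∑ v, Real.log (a v + 1 : ℕ)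
        + ((∑ v, (a v + 1 : ℕ) * (((a v + 1 : ℕ) : ℝ) - 1)) / (4 * (n + 3 + (Y + 1) : ℕ))
          + ((∑ v, (a v + 1 : ℕ) * (((a v + 1 : ℕ) : ℝ) - 1)) / (4 * (n + 3 + (Y + 1) : ℕ))) ^ 2)
        + ((n + 3) * Real.log 2 - Real.log 2 + Real.log (n + 3 + 2 * (Y + 1)).factorial
          + Real.log (n + 3 + (Y + 1)).factorial - Real.log (Y + 1 + 1).factorial
          - Real.log (2 * (n + 3 + (Y + 1))).factorial))| ≤
      (80 : ℝ) * D ^ 6 / (n + 3 + (Y + 1) : ℕ) + 36 * (D ^ 2 * (Y + 1) / (n + 1)) := by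
  have hsumd : ∑ v, (a v + 1) = 2 * (n + 3 + (Y + 1)) := by
    rw [sum_add_distrib, hsum]
    simp [hV]
    ring
  obtain ⟨hg, hden⟩ := abs_log_card_graphsWithDegrees_add_le hD1 hDm hD hsumd
  have hup := sum_card_spanning_trees_mul_le (X := Y + 1) hV hsum
  have hlow := le_sum_card_spanning_trees_mul hV hY hsum hD1 (fun v => by have := hD v; omega)
  have hlogW := log_oddFactorial_mul_choose n (Y + 1)
  have hlogodd := log_oddFactorial (n + 3 + (Y + 1))
  have hWpos : (0 : ℝ) < oddFactorial (Y + 1 + 1) * (n + 1).factorial *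
      (n + 3 + 2 * (Y + 1)).choose (n + 1) := by
    have h1 : 0 < (n + 3 + 2 * (Y + 1)).choose (n + 1) := Nat.choose_pos (by omega)
    have h2 := oddFactorial_pos (Y + 1 + 1)
    have h3 := Nat.factorial_pos (n + 1)
    exact_mod_cast Nat.mul_pos (Nat.mul_pos h2 h3) h1
  have hup' := (Nat.cast_le (α := ℝ)).2 hup
  have hodd : (0 : ℝ) < oddFactorial (n + 3 + (Y + 1)) := by
    exact_mod_cast oddFactorial_pos (n + 3 + (Y + 1))
  have hP : (0 : ℝ) < (∏ v, (a v).factorial : ℕ) := by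
    exact_mod_cast prod_pos fun v _ => Nat.factorial_pos (a v)
  have hprod : (∏ v, (a v + 1).factorial) = (∏ v, (a v + 1)) * ∏ v, (a v).factorial := by
    rw [← prod_mul_distrib]
    rfl
  have hlogprod : Real.log ((∏ v, (a v + 1) : ℕ) : ℝ) = ∑ v, Real.log (a v + 1 : ℕ) := by
    rw [Nat.cast_prod, Real.log_prod fun v _ => by positivity]
  have hA : (0 : ℝ) < ((∏ v, (a v + 1) : ℕ) : ℝ) := by
    exact_mod_cast prod_pos fun v _ => Nat.succ_pos (a v)
  have hg' : (0 : ℝ) < #(graphsWithDegrees fun v => a v + 1) := by exact_mod_cast hg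
  rw [hprod] at hden
  generalize (∑ G ∈ graphsWithDegrees fun v => a v + 1,
    #{T : SimpleGraph V | T ≤ G ∧ T.IsTree}) = N at *
  generalize #(graphsWithDegrees fun v => a v + 1) = g at *
  rw [← hlogprod]
  push_cast at hup' hden hlow hP hA ⊢
  generalize (∏ v, ((a v).factorial : ℝ)) = P at *
  generalize (∏ v, ((a v : ℝ) + 1)) = A at *
  generalize (oddFactorial (Y + 1 + 1) * (n + 1).factorial *
      (n + 3 + 2 * (Y + 1)).choose (n + 1) : ℝ) = W at *
  generalize (∑ v, ((a v : ℝ) + 1) * ((a v : ℝ) + 1 - 1)) = M at *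
  generalize (oddFactorial (n + 3 + (Y + 1)) : ℝ) = O at *
  have hNP : 0 < (N : ℝ) * P :=
    lt_of_lt_of_le (mul_pos hWpos (by linarith)) hlow
  have hN : (0 : ℝ) < N := pos_of_mul_pos_left hNP hP.le
  refine ⟨by exact_mod_cast hN, hg, ?_⟩
  have hq := abs_log_le_of_one_sub_le (θ := (18 : ℝ) * D ^ 2 * (Y + 1) / (n + 1))
    (q := N * P / W) (by positivity) hθ (by rw [le_div_iff₀ hWpos, mul_comm]; exact hlow)
    (by rw [div_le_one hWpos]; exact hup')
  rw [Real.log_div (by positivity) hWpos.ne', Real.log_mul hN.ne' hP.ne', hlogW] at hq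
  rw [Real.log_div (by positivity) hodd.ne', Real.log_mul hg'.ne' (by positivity),
    Real.log_mul hA.ne' hP.ne', hlogodd] at hden
  rw [Real.log_div hN.ne' hg'.ne']
  push_cast at hden hq
  have e : (18 : ℝ) * D ^ 2 * (Y + 1) / (n + 1) = 18 * (D ^ 2 * (Y + 1) / (n + 1)) := by ring
  rw [e] at hq
  have h1 := abs_le.1 hq
  have h2 := abs_le.1 hden
  rw [abs_le]
  constructor <;> linarith [h1.1, h1.2, h2.1, h2.2]

end ExpectedSpanningTrees

section ErrorTerms

open Finset

lemma abs_exponent_sub_le {R h D δ l : ℝ} (hR0 : 0 ≤ R) (hRD : R ≤ 3 * D) (hD : 1 ≤ D)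
    (h0 : 0 ≤ h) (h1 : h ≤ 1) (hδ : δ = 2 + h) (hl : l = R / (2 * δ) + (δ - 1) / 2) :
    |l + l ^ 2 - (6 + R) * (2 + R) / 16| ≤ 4 * (h * D ^ 2) := by
  have hδ0 : 2 ≤ δ := by linarith
  have hq0 : 0 ≤ R / δ := by positivity
  have hq1 : R / δ ≤ R / 2 := by gcongr
  have hfac : l + l ^ 2 - (6 + R) * (2 + R) / 16 =
      h * (1 / 2 - R / δ / 4) * (R / δ / 2 + (δ - 1) / 2 + R / 4 + 3 / 2) := by
    have e : h = δ - 2 := by linarith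
    rw [hl, e]
    field_simp
    ring
  rw [hfac, abs_mul, abs_mul, abs_of_nonneg h0]
  have b1 : |1 / 2 - R / δ / 4| ≤ D := by
    rw [abs_le]; constructor <;> linarith
  have b2 : |R / δ / 2 + (δ - 1) / 2 + R / 4 + 3 / 2| ≤ 4 * D := by
    rw [abs_le]; constructor <;> linarith
  calc h * |1 / 2 - R / δ / 4| * |R / δ / 2 + (δ - 1) / 2 + R / 4 + 3 / 2|
      ≤ h * D * (4 * D) := by gcongr
    _ = _ := by ring

lemma degree_moment_eq {ι : Type} [Fintype ι] {d : ι → ℝ} {n m δ R : ℝ} (hn : 0 < n) (hδ0 : 0 < δ)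
    (hcard : (Fintype.card ι : ℝ) = n) (hm : ∑ i, d i = 2 * m) (hδ : ∑ i, d i = n * δ)
    (hR : R = (∑ i, (d i - δ) ^ 2) / n) :
    (∑ i, d i * (d i - 1)) / (4 * m) = R / (2 * δ) + (δ - 1) / 2 := by
  have h1 : ∑ i, d i * (d i - 1) = ∑ i, (d i - δ) ^ 2 + (2 * δ - 1) * ∑ i, d i - n * δ ^ 2 := by
    rw [mul_sum, ← hcard, ← nsmul_eq_mul, ← card_univ, ← sum_const, ← sum_add_distrib,
      ← sum_sub_distrib]
    exact sum_congr rfl fun i _ => by ring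
  have h2 : ∑ i, (d i - δ) ^ 2 = n * R := by rw [hR]; field_simp
  have h3 : 4 * m = 2 * (n * δ) := by linarith
  rw [h1, h2, hδ, h3]
  field_simp
  ring

lemma variance_le {ι : Type} [Fintype ι] {d : ι → ℝ} {n δ R D : ℝ} (hn : 0 < n) (hδ3 : δ ≤ 3)
    (hD0 : 0 ≤ D) (hcard : (Fintype.card ι : ℝ) = n) (hδ : ∑ i, d i = n * δ)
    (hd0 : ∀ i, 0 ≤ d i) (hD : ∀ i, d i ≤ D) (hR : R = (∑ i, (d i - δ) ^ 2) / n) :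
    R ≤ 3 * D := by
  have h1 : ∑ i, (d i - δ) ^ 2 = ∑ i, d i ^ 2 - 2 * δ * ∑ i, d i + n * δ ^ 2 := by
    rw [mul_sum, ← hcard, ← nsmul_eq_mul, ← card_univ, ← sum_const, ← sum_sub_distrib,
      ← sum_add_distrib]
    exact sum_congr rfl fun i _ => by ring
  have h2 : ∑ i, d i ^ 2 ≤ D * ∑ i, d i := by
    rw [mul_sum]
    refine sum_le_sum fun i _ => ?_
    nlinarith [hd0 i, hD i]
  rw [hR, div_le_iff₀ hn, h1, hδ]
  rw [hδ] at h2
  nlinarith [mul_nonneg hn.le (sq_nonneg δ), mul_nonneg hD0 (mul_nonneg hn.le (sub_nonneg.2 hδ3))]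

lemma loss_condition {D x n : ℝ} (hD : 1 ≤ D) (hDx : D ^ 4 ≤ 2 * x) (hx0 : 0 ≤ x)
    (hxn : x ≤ √n) (hn : (10 : ℝ) ^ 12 ≤ n) :
    100 * D ^ 4 ≤ n ∧ 18 * D ^ 2 * x / (n - 2) ≤ 1 / 2 := by
  have hn0 : 0 ≤ n := le_trans (by norm_num) hn
  have hw : (10 : ℝ) ^ 6 ≤ √n := by
    rw [Real.le_sqrt' (by norm_num)]
    linarith
  have hsq := Real.sq_sqrt hn0
  set w := √n
  constructor
  · nlinarith
  · have h1 : (72 * (D ^ 2 * x)) ^ 2 ≤ n ^ 2 := by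
      have h2 : (D ^ 2 * x) ^ 2 ≤ 2 * w * w ^ 2 := by
        calc (D ^ 2 * x) ^ 2 = D ^ 4 * x ^ 2 := by ring
          _ ≤ 2 * w * w ^ 2 := by gcongr; linarith
      have h3 : 10 ^ 6 * w ^ 3 ≤ w * w ^ 3 := by gcongr
      rw [← hsq]
      nlinarith [pow_nonneg (le_trans (by norm_num) hw : 0 ≤ w) 3]
    have h4 : 72 * (D ^ 2 * x) ≤ n := by
      rwa [sq_le_sq₀ (by positivity) hn0] at h1
    rw [div_le_iff₀ (by linarith)]
    linarith

lemma error_terms_le {D x n : ℝ} (hD : 1 ≤ D) (hDx : D ^ 4 ≤ 2 * x) (hx : 1 ≤ x)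
    (hxn : x ^ 2 ≤ n) (hn : (10 : ℝ) ^ 12 ≤ n) :
    80 * D ^ 6 / (n + x) + 36 * (D ^ 2 * x / (n - 2)) + 4 * (2 * x / n * D ^ 2)
      + (1 / (n + 2 * x) + 1 / (n + x) + 1 / x + 1 / x + 1 / (2 * n + 2 * x))
      + (36 * (x ^ 3 / n ^ 2) + 1 / x) ≤ 300 * (D ^ 4 / x + x ^ 3 / n ^ 2) := by
  have hn0 : 0 < n := lt_of_lt_of_le (by norm_num) hn
  have hx0 : 0 < x := by linarith
  have hD2 : D ^ 2 ≤ D ^ 4 := pow_le_pow_right₀ hD (by norm_num)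
  have hD4 : 1 ≤ D ^ 4 := one_le_pow₀ hD
  have a1 : 80 * D ^ 6 / (n + x) ≤ 160 * (D ^ 4 / x) := by
    rw [← mul_div_assoc, div_le_div_iff₀ (by positivity) hx0]
    have h1 : D ^ 2 * x ≤ 2 * (n + x) := by nlinarith
    nlinarith [mul_le_mul_of_nonneg_left h1 (by positivity : 0 ≤ D ^ 4)]
  have a0 : x / n ≤ 1 / x := by
    rw [div_le_div_iff₀ hn0 hx0]; linarith
  have a2 : D ^ 2 * x / (n - 2) ≤ 2 * (D ^ 4 / x) := by
    have hn2 : n / 2 ≤ n - 2 := by linarith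
    calc D ^ 2 * x / (n - 2) ≤ D ^ 4 * x / (n / 2) := by gcongr
      _ = 2 * D ^ 4 * (x / n) := by field_simp
      _ ≤ 2 * D ^ 4 * (1 / x) := by gcongr
      _ = _ := by ring
  have a3 : 2 * x / n * D ^ 2 ≤ 2 * (D ^ 4 / x) := by
    calc 2 * x / n * D ^ 2 = 2 * D ^ 2 * (x / n) := by ring
      _ ≤ 2 * D ^ 4 * (1 / x) := by gcongr
      _ = _ := by ring
  have a4 : 1 / x ≤ D ^ 4 / x := by gcongr
  have a5 : 1 / (n + 2 * x) ≤ 1 / x := one_div_le_one_div_of_le hx0 (by linarith)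
  have a6 : 1 / (n + x) ≤ 1 / x := one_div_le_one_div_of_le hx0 (by linarith)
  have a7 : 1 / (2 * n + 2 * x) ≤ 1 / x := one_div_le_one_div_of_le hx0 (by linarith)
  have a8 : 0 ≤ x ^ 3 / n ^ 2 := by positivity
  have a9 : 0 ≤ D ^ 4 / x := by positivity
  linarith

/-- Stirling's formula for the factorials in the expected number of spanning trees. -/
lemma abs_log_factorials_sub_le {n X : ℕ} (hX : 1 ≤ X) (hXn : 4 * X ≤ n) (hX2 : X ^ 2 ≤ n) :
    |(n * Real.log 2 - Real.log 2 + Real.log (n + 2 * X).factorial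
          + Real.log (n + X).factorial - Real.log (X + 1).factorial
          - Real.log (2 * (n + X)).factorial)
      - (-Real.log n + X * (1 - Real.log 2) + (3 / 2 + X) * (Real.log n - Real.log (2 * X))
        - n * Real.log 2 + 3 * X ^ 2 / (2 * n))| ≤
      (1 / (n + 2 * X) + 1 / (n + X) + 1 / X + 1 / X + 1 / (2 * n + 2 * X) : ℝ)
        + (36 * ((X : ℝ) ^ 3 / n ^ 2) + 1 / X) := by
  have hx1 : (1 : ℝ) ≤ X := by exact_mod_cast hX
  have h0 := abs_le.1 (abs_stirlingMain_combination_le (n := n) (x := X) hx1 (by exact_mod_cast hXn)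
    (by exact_mod_cast hX2))
  have h1 := abs_le.1 (abs_log_factorial_sub_le (k := n + 2 * X) (by omega))
  have h2 := abs_le.1 (abs_log_factorial_sub_le (k := n + X) (by omega))
  have h3 := abs_le.1 (abs_log_factorial_sub_le (k := X) hX)
  have h4 := abs_le.1 (abs_log_factorial_sub_le (k := 2 * (n + X)) (by omega))
  have h5 : Real.log (X + 1).factorial = Real.log (X + 1) + Real.log X.factorial := by
    rw [Nat.factorial_succ, Nat.cast_mul, Real.log_mul (by positivity) (by positivity)]
    push_cast
    rfl
  have h6 : Real.log X ≤ Real.log (X + 1) := Real.log_le_log (by positivity) (by linarith)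
  have h7 : Real.log (X + 1) ≤ Real.log X + 1 / X := by
    have e : (X : ℝ) + 1 = X * (1 + 1 / X) := by field_simp
    rw [e, Real.log_mul (by positivity) (by positivity)]
    have := Real.log_le_sub_one_of_pos (by positivity : (0 : ℝ) < 1 + 1 / X)
    linarith
  push_cast at h1 h2 h4
  rw [mul_add] at h4
  rw [h5, abs_le]
  constructor <;> linarith [h0.1, h0.2, h1.1, h1.2, h2.1, h2.2, h3.1, h3.2, h4.1, h4.2]

end ErrorTerms

section MainTheorem

open Finset

/-- The main term of the expansion, written as an exponential. -/
lemma main_term_eq_exp {n : ℕ} (hn : 0 < n) {d : Fin n → ℕ} (hd : ∀ j, 1 ≤ d j) {x : ℝ}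
    (hx : 0 < x) (A : ℝ) :
    (1 / n) * (Real.exp 1 / 2) ^ x * ((n : ℝ) / (2 * x)) ^ ((3 : ℝ) / 2 + x) *
        ((∏ j, (d j : ℝ)) ^ ((1 : ℝ) / n) / 2) ^ (n : ℝ) * Real.exp A =
      Real.exp (-Real.log n + x * (1 - Real.log 2) +
        (3 / 2 + x) * (Real.log n - Real.log (2 * x)) +
        (∑ j, Real.log (d j) - n * Real.log 2) + A) := by
  have hn0 : (0 : ℝ) < n := by exact_mod_cast hn
  have hdpos : ∀ j, (0 : ℝ) < d j := fun j => by exact_mod_cast hd j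
  have hP : (0 : ℝ) < ∏ j, (d j : ℝ) := prod_pos fun j _ => hdpos j
  have hP' : (0 : ℝ) < (∏ j, (d j : ℝ)) ^ ((1 : ℝ) / n) := Real.rpow_pos_of_pos hP _
  have e1 : (1 : ℝ) / n = Real.exp (-Real.log n) := by
    rw [Real.exp_neg, Real.exp_log hn0, one_div]
  have e2 : (Real.exp 1 / 2) ^ x = Real.exp (x * (1 - Real.log 2)) := by
    rw [Real.rpow_def_of_pos (by positivity), Real.log_div (by positivity) (by positivity),
      Real.log_exp, mul_comm]
  have e3 : ((n : ℝ) / (2 * x)) ^ ((3 : ℝ) / 2 + x) =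
      Real.exp ((3 / 2 + x) * (Real.log n - Real.log (2 * x))) := by
    rw [Real.rpow_def_of_pos (by positivity), Real.log_div (by positivity) (by positivity),
      mul_comm]
  have e4 : ((∏ j, (d j : ℝ)) ^ ((1 : ℝ) / n) / 2) ^ (n : ℝ) =
      Real.exp (∑ j, Real.log (d j) - n * Real.log 2) := by
    rw [Real.rpow_def_of_pos (by positivity), Real.log_div hP'.ne' (by positivity),
      Real.log_rpow hP, Real.log_prod fun j _ => (hdpos j).ne']
    congr 1
    field_simp
  rw [e4, e3, e2, Real.exp_add, Real.exp_add, Real.exp_add, Real.exp_add, ← e1]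

/-- Logarithm of the expected number of spanning trees for a degree sequence whose average exceeds
`2` by `2 * (Y + 1) / (N + 3)`. -/
lemma abs_log_expected_sub_le {V : Type} [Fintype V] {N Y D : ℕ} (hV : Fintype.card V = N + 3)
    {d : V → ℕ} (hd : ∀ j, 1 ≤ d j)
    (hN : (10 : ℝ) ^ 12 ≤ (N + 3 : ℕ)) (hY : 1 ≤ Y) (hsum : ∑ j, d j = 2 * (N + 3) + 2 * (Y + 1))
    (hD1 : 1 ≤ D) (hD : ∀ j, d j ≤ D) (hDx : D ^ 4 ≤ 2 * (Y + 1)) (hxn : (Y + 1) ^ 2 ≤ N + 3)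
    {δ R : ℝ} (hδ : δ = 2 + 2 * ((Y + 1 : ℕ) : ℝ) / (N + 3 : ℕ))
    (hR : R = (∑ j, ((d j : ℝ) - δ) ^ 2) / (N + 3 : ℕ)) :
    0 < ((∑ G ∈ graphsWithDegrees d, #{T : SimpleGraph (V) | T ≤ G ∧ T.IsTree} : ℕ) : ℝ) /
      #(graphsWithDegrees d) ∧
    |Real.log (((∑ G ∈ graphsWithDegrees d,
          #{T : SimpleGraph (V) | T ≤ G ∧ T.IsTree} : ℕ) : ℝ) / #(graphsWithDegrees d)) -
      (-Real.log (N + 3 : ℕ) + (Y + 1 : ℕ) * (1 - Real.log 2) +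
        (3 / 2 + (Y + 1 : ℕ)) * (Real.log (N + 3 : ℕ) - Real.log (2 * (Y + 1 : ℕ))) +
        (∑ j, Real.log (d j) - (N + 3 : ℕ) * Real.log 2) +
        ((6 + R) * (2 + R) / 16 + 3 * ((Y + 1 : ℕ) : ℝ) ^ 2 / (2 * (N + 3 : ℕ))))| ≤
      300 * ((D : ℝ) ^ 4 / (Y + 1 : ℕ) + ((Y + 1 : ℕ) : ℝ) ^ 3 / ((N + 3 : ℕ) : ℝ) ^ 2) := by
  obtain ⟨a, rfl⟩ : ∃ a : V → ℕ, d = fun v => a v + 1 :=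
    ⟨fun v => d v - 1, funext fun v => by have := hd v; simp only; omega⟩
  have hsuma : ∑ v, a v = N + 3 + 2 * (Y + 1) := by
    simp only [sum_add_distrib, sum_const, card_univ, hV, smul_eq_mul] at hsum
    omega
  have hDR : (1 : ℝ) ≤ D := by exact_mod_cast hD1
  have hDxR : (D : ℝ) ^ 4 ≤ 2 * ((Y + 1 : ℕ) : ℝ) := by exact_mod_cast hDx
  have hxnR : ((Y + 1 : ℕ) : ℝ) ^ 2 ≤ ((N + 3 : ℕ) : ℝ) := by exact_mod_cast hxn
  have hx1 : (1 : ℝ) ≤ ((Y + 1 : ℕ) : ℝ) := by exact_mod_cast Nat.le_add_left 1 Y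
  have h4x : 4 * (Y + 1) ≤ N + 3 := by
    have h16 : 16 ≤ N + 3 := by
      have : (16 : ℝ) ≤ (N + 3 : ℕ) := le_trans (by norm_num) hN
      exact_mod_cast this
    rcases le_total 4 (Y + 1) with h | h
    · calc 4 * (Y + 1) ≤ (Y + 1) * (Y + 1) := Nat.mul_le_mul_right _ h
        _ ≤ N + 3 := by rw [← sq]; exact hxn
    · omega
  obtain ⟨hl1, hl2⟩ := loss_condition hDR hDxR (by linarith) (Real.le_sqrt_of_sq_le hxnR) hN
  have hn2 : ((N + 3 : ℕ) : ℝ) - 2 = N + 1 := by push_cast; ring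
  have hY1 : ((Y + 1 : ℕ) : ℝ) = Y + 1 := by push_cast; ring
  obtain ⟨hnum, hden, hmain⟩ := abs_log_expected_spanning_trees_sub_le hV hY hsuma hD1 hD
    (by have : 100 * D ^ 4 ≤ N + 3 := by exact_mod_cast hl1
        omega)
    (by rw [hn2, hY1] at hl2; exact hl2)
  refine ⟨div_pos (Nat.cast_pos.2 hnum) (Nat.cast_pos.2 hden), ?_⟩
  have hfac := abs_log_factorials_sub_le (n := N + 3) (X := Y + 1) (by omega) h4x hxn
  have herr := error_terms_le hDR hDxR hx1 hxnR hN
  have hn0 : (0 : ℝ) < ((N + 3 : ℕ) : ℝ) := by positivity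
  set n : ℝ := ((N + 3 : ℕ) : ℝ) with hn
  set x : ℝ := ((Y + 1 : ℕ) : ℝ) with hx
  have hδ' : ∑ j, ((a j + 1 : ℕ) : ℝ) = n * δ := by
    rw [← Nat.cast_sum, hsum, hδ]
    push_cast
    rw [← hY1]
    field_simp
    rw [hn]
    push_cast
    ring
  have h1 : 2 * x / n ≤ 1 := by
    rw [div_le_one hn0]
    have : 4 * x ≤ n := by rw [hx, hn]; exact_mod_cast h4x
    linarith
  have hh0 : 0 ≤ 2 * x / n := by positivity
  have hcard : (Fintype.card V : ℝ) = n := by rw [hV]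
  have hRD := variance_le (D := (D : ℝ)) hn0 (by linarith) (by linarith) hcard hδ'
    (fun j => by positivity) (fun j => by exact_mod_cast hD j) hR
  have hmom := degree_moment_eq (m := ((N + 3 + (Y + 1) : ℕ) : ℝ)) hn0 (by linarith) hcard
    (by rw [← Nat.cast_sum, hsum]; push_cast; ring) hδ' hR
  have hexp := abs_exponent_sub_le (by rw [hR]; positivity) hRD hDR hh0 h1 hδ rfl
  rw [hmom] at hmain
  have hmc : ((N + 3 + (Y + 1) : ℕ) : ℝ) = n + x := by rw [hn, hx]; push_cast; ring
  have hN3 : ((N : ℝ) + 3) = n := by rw [hn]; push_cast; ring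
  rw [hmc, hN3, ← hY1, ← hn2] at hmain
  rw [abs_le] at hmain hfac hexp ⊢
  constructor <;> linarith [hmain.1, hmain.2, hfac.1, hfac.2, hexp.1, hexp.2]

end MainTheorem

theorem expected_spanning_trees_average_degree_close_to_two :
    ∃ C : ℝ, 0 < C ∧ ∃ N₀ : ℕ, ∀ n : ℕ, N₀ ≤ n → ∀ dseq : Fin n → ℕ,
      (∀ j, 1 ≤ dseq j) → Even (∑ j, dseq j) →
      ∀ dmax davg dhat R x : ℝ,
      dmax = (Finset.univ.sup dseq : ℕ) →
      davg = (∑ j, (dseq j : ℝ)) / n →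
      dhat = (∏ j, (dseq j : ℝ)) ^ ((1 : ℝ) / n) →
      R = (∑ j, ((dseq j : ℝ) - davg) ^ 2) / n →
      davg = 2 + 2 * x / n →
      (1 / 2) * dmax ^ 4 ≤ x → x ≤ Real.sqrt n →
      ∃ E : ℝ,
        |E| ≤ C * (dmax ^ 4 / x + x ^ 3 / n ^ 2) ∧
        (∑ G ∈ Finset.univ.filter
              (fun G : SimpleGraph (Fin n) => ∀ j, G.degree j = dseq j),
            (spanningTreeCount G : ℝ)) /
          ((Finset.univ.filter
              (fun G : SimpleGraph (Fin n) => ∀ j, G.degree j = dseq j)).card : ℝ)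
        = (1 / n) * (Real.exp 1 / 2) ^ x * ((n : ℝ) / (2 * x)) ^ ((3 : ℝ) / 2 + x) *
            (dhat / 2) ^ (n : ℝ) *
            Real.exp ((6 + R) * (2 + R) / 16 + 3 * x ^ 2 / (2 * n) + E) := by
  refine ⟨300, by norm_num, 10 ^ 12, ?_⟩
  intro n hN dseq hd hev dmax davg dhat R x hdmax havg hdhat hR hx hxl hxu
  obtain ⟨N, rfl⟩ : ∃ N, n = N + 3 := ⟨n - 3, by omega⟩
  have hn0 : (0 : ℝ) < ((N + 3 : ℕ) : ℝ) := by positivity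
  have hle : ∀ j, dseq j ≤ Finset.univ.sup dseq := fun j => Finset.le_sup (Finset.mem_univ j)
  set D := Finset.univ.sup dseq with hDdef
  have hD1 : 1 ≤ D := (hd 0).trans (hle 0)
  obtain ⟨k, hk⟩ := hev
  have hkx : (k : ℝ) = (N + 3 : ℕ) + x := by
    have h1 : (∑ j, (dseq j : ℝ)) = (k : ℝ) + k := by exact_mod_cast hk
    rw [havg, h1] at hx
    field_simp at hx
    linarith
  have hDR : (1 : ℝ) ≤ D := by exact_mod_cast hD1
  have hx0 : 0 < x := by
    have : (1 : ℝ) ≤ (D : ℝ) ^ 4 := one_le_pow₀ hDR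
    rw [hdmax] at hxl
    linarith
  have hD3 : 3 ≤ D := by
    by_contra hlt
    have h1 : ∑ j, dseq j ≤ ∑ _j : Fin (N + 3), 2 :=
      Finset.sum_le_sum fun j _ => (hle j).trans (by omega)
    simp only [Finset.sum_const, Finset.card_univ, Fintype.card_fin, smul_eq_mul] at h1
    have h2 : k ≤ N + 3 := by omega
    have h3 : (k : ℝ) ≤ (N + 3 : ℕ) := by exact_mod_cast h2
    linarith
  obtain ⟨X, rfl⟩ : ∃ X, k = N + 3 + X := by
    refine Nat.exists_eq_add_of_le ?_
    have : ((N + 3 : ℕ) : ℝ) ≤ k := by linarith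
    exact_mod_cast this
  have hxX : x = X := by
    rw [Nat.cast_add] at hkx
    linarith
  subst hxX
  have hDx : D ^ 4 ≤ 2 * X := by
    have : (D : ℝ) ^ 4 ≤ 2 * X := by rw [hdmax] at hxl; linarith
    exact_mod_cast this
  have h81 : 3 ^ 4 ≤ D ^ 4 := Nat.pow_le_pow_left hD3 4
  obtain ⟨Y, rfl⟩ : ∃ Y, X = Y + 1 := ⟨X - 1, by omega⟩
  have hX2 : (Y + 1) ^ 2 ≤ N + 3 := by
    have := (Real.le_sqrt' hx0).1 hxu
    exact_mod_cast this
  obtain ⟨hpos, hE⟩ := abs_log_expected_sub_le (Fintype.card_fin _) hd (by exact_mod_cast hN) (by omega) (by rw [hk]; ring) hD1 hle hDx hX2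
    hx hR
  have hgr : Finset.univ.filter (fun G : SimpleGraph (Fin (N + 3)) => ∀ j, G.degree j = dseq j) =
      graphsWithDegrees dseq := by
    ext G
    simp only [mem_graphsWithDegrees, Finset.mem_filter, Finset.mem_univ, true_and]
  refine ⟨_, hdmax ▸ hE, ?_⟩
  rw [hdhat, main_term_eq_exp (by omega) hd hx0, ← add_assoc, add_sub_cancel,
    Real.exp_log hpos, hgr, Nat.cast_sum]
  refine congrArg (· / _) (Finset.sum_congr rfl fun G _ => ?_)
  rw [Nat.cast_inj, spanningTreeCount]
  refine congrArg Finset.card (Finset.ext fun T => ?_)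
  simp only [Finset.mem_filter, Finset.mem_univ, true_and]
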